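/- There exists a constant C > 0 (independent of N and L) such that for every L ≥ 1, every N ≥ 1 and every φ : {0,1,…,N} → [0,∞), Ent_γ(φ) ≤ C N Σ_{n=1}^{N} [γ(n) ∧ γ(n−1)] (√φ(n) − √φ(n−1))². -/

import Mathlib

open scoped BigOperators

noncomputable section

/-- `cfact c k = c(k)! = c(1)⋯c(k)`, with `cfact c 0 = 1`. -/
def cfact (c : ℕ → ℝ) : ℕ → ℝ
  | 0 => 1
  | k + 1 => cfact c k * c (k + 1)

/-- The configuration obtained from `η` by moving one particle from `x` to `y` (`x ≠ y`),
i.e. `η - δ^x + δ^y`. -/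
def move (η : ℤ → ℕ) (x y : ℤ) : ℤ → ℕ :=
  fun z => if z = x then η x - 1 else if z = y then η y + 1 else η z

/-- Unnormalized weight of the canonical measure `ν_Λ^N` on configurations supported in `Λ`
with `N` particles: `∏_{x∈Λ} 1/c(η_x)!`. -/
def nuW (c : ℕ → ℝ) (Λ : Finset ℤ) (N : ℕ) : (ℤ → ℕ) → ℝ :=
  Set.indicator {η : ℤ → ℕ | (∀ x, x ∉ Λ → η x = 0) ∧ (∑ x ∈ Λ, η x) = N}
    (fun η => ∏ x ∈ Λ, (cfact c (η x))⁻¹)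

/-- Expectation with respect to the probability measure obtained by normalizing the
nonnegative weight `w`. -/
def wE (w f : (ℤ → ℕ) → ℝ) : ℝ :=
  (∑' η : ℤ → ℕ, w η * f η) / (∑' η : ℤ → ℕ, w η)

/-- Covariance `μ[f,g] = μ[f g] - μ[f] μ[g]`. -/
def wCov (w f g : (ℤ → ℕ) → ℝ) : ℝ :=
  wE w (fun η => f η * g η) - wE w f * wE w g

/-- Entropy `Ent_μ(f) = μ[f log f] - μ[f] log μ[f]` (note `Real.log 0 = 0`, giving the
convention `0 log 0 = 0`). -/
def wEnt (w f : (ℤ → ℕ) → ℝ) : ℝ :=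
  wE w (fun η => f η * Real.log (f η)) - wE w f * Real.log (wE w f)

/-- Dirichlet form of the zero-range process on `Λ`:
`E(f,g) = (1/2) Σ_{x∈Λ} Σ_{y∈Λ, |x-y|=1} μ[c(η_x) ∂_{xy}f ∂_{xy}g]`. -/
def wDir (c : ℕ → ℝ) (Λ : Finset ℤ) (w f g : (ℤ → ℕ) → ℝ) : ℝ :=
  wE w (fun η => (1 / 2) * ∑ x ∈ Λ, ∑ y ∈ Λ,
    if |x - y| = 1 then c (η x) * ((f (move η x y) - f η) * (g (move η x y) - g η)) else 0)

/-- Weight conditioned on the event `∑_{x ∈ Λ₁} η x = n`. -/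
def condW (w : (ℤ → ℕ) → ℝ) (Λ₁ : Finset ℤ) (n : ℕ) : (ℤ → ℕ) → ℝ :=
  Set.indicator {η : ℤ → ℕ | (∑ x ∈ Λ₁, η x) = n} w

/-- `h(n) = (n+1)/c(n+1)`. -/
def hfun (c : ℕ → ℝ) (n : ℕ) : ℝ := (n + 1) / c (n + 1)

/-- The segment `Λ₁ = [a, a+L) ∩ ℤ`. -/
def seg1 (a : ℤ) (L : ℕ) : Finset ℤ := Finset.Ico a (a + (L : ℤ))

/-- The adjacent segment `Λ₂ = [a+L, a+2L) ∩ ℤ`. -/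
def seg2 (a : ℤ) (L : ℕ) : Finset ℤ := Finset.Ico (a + (L : ℤ)) (a + 2 * (L : ℤ))

/-- `Λ = Λ₁ ∪ Λ₂ = [a, a+2L) ∩ ℤ`. -/
def segL (a : ℤ) (L : ℕ) : Finset ℤ := Finset.Ico a (a + 2 * (L : ℤ))

/-- `γ(n) = ν_Λ^N[η̄_{Λ₁} = n]`. -/
def gammaP (c : ℕ → ℝ) (a : ℤ) (L N : ℕ) (n : ℕ) : ℝ :=
  wE (nuW c (segL a L) N)
    (Set.indicator {η : ℤ → ℕ | (∑ x ∈ seg1 a L, η x) = n} (fun _ => (1 : ℝ)))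

/-- Entropy of `φ` with respect to the probability `γ` on `{0,…,N}`. -/
def entGamma (γ φ : ℕ → ℝ) (N : ℕ) : ℝ :=
  (∑ n ∈ Finset.range (N + 1), γ n * (φ n * Real.log (φ n))) -
    (∑ n ∈ Finset.range (N + 1), γ n * φ n) *
      Real.log (∑ n ∈ Finset.range (N + 1), γ n * φ n)

/-- generic convolution step -/
lemma conv_shift_left (u U f : ℕ → ℝ) (A : ℝ) (hf0 : f 0 = 0)
    (hf : ∀ k, f (k+1) * u (k+1) = A * u k) (G : ℕ → ℕ → ℝ) (n : ℕ) :
    ∑ p ∈ Finset.HasAntidiagonal.antidiagonal (n+1), f p.1 * G p.1 p.2 * (u p.1 * U p.2)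
      = A * ∑ p ∈ Finset.HasAntidiagonal.antidiagonal n, G (p.1+1) p.2 * (u p.1 * U p.2) := by
  rw [Finset.Nat.sum_antidiagonal_succ, Finset.mul_sum]
  simp only [hf0, zero_mul, zero_add]
  refine Finset.sum_congr rfl fun p _ => ?_
  have := hf p.1
  linear_combination (G (p.1+1) p.2 * U p.2) * this

lemma conv_shift_right (u U F : ℕ → ℝ) (B : ℝ) (hF0 : F 0 = 0)
    (hF : ∀ k, F (k+1) * U (k+1) = B * U k) (G : ℕ → ℕ → ℝ) (n : ℕ) :
    ∑ p ∈ Finset.HasAntidiagonal.antidiagonal (n+1), F p.2 * G p.1 p.2 * (u p.1 * U p.2)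
      = B * ∑ p ∈ Finset.HasAntidiagonal.antidiagonal n, G p.1 (p.2+1) * (u p.1 * U p.2) := by
  rw [Finset.Nat.sum_antidiagonal_succ', Finset.mul_sum]
  simp only [hF0, zero_mul, zero_add]
  refine Finset.sum_congr rfl fun p _ => ?_
  have := hF p.2
  linear_combination (G p.1 (p.2+1) * u p.1) * this

/-- A "good pair": a positive weight `u` with `f (k+1) u (k+1) = A u k`, linear bounds and
one-sided Lipschitz bound on `f`. -/
structure GoodPair (a₁ δ A : ℝ) (u f : ℕ → ℝ) : Prop where
  pos : ∀ n, 0 < u n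
  f0 : f 0 = 0
  rcr : ∀ k, f (k+1) * u (k+1) = A * u k
  lb : ∀ n : ℕ, δ * n ≤ f n
  ub : ∀ n : ℕ, f n ≤ a₁ * n
  lip : ∀ n : ℕ, f (n+1) ≤ f n + a₁

/-- convolution -/
noncomputable def cv (u U : ℕ → ℝ) (n : ℕ) : ℝ := ∑ p ∈ Finset.HasAntidiagonal.antidiagonal n, u p.1 * U p.2

/-- ratio sequence -/
noncomputable def ratioSeq (A : ℝ) (V : ℕ → ℝ) : ℕ → ℝ
  | 0 => 0
  | n+1 => A * V n / V (n+1)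

lemma cv_pos {u U : ℕ → ℝ} (hu : ∀ n, 0 < u n) (hU : ∀ n, 0 < U n) (n : ℕ) : 0 < cv u U n := by
  refine Finset.sum_pos (fun p _ => mul_pos (hu _) (hU _)) ⟨(0, n), by simp⟩

lemma GoodPair.conv {a₁ δ A B : ℝ} {u f U F : ℕ → ℝ} (h : GoodPair a₁ δ A u f)
    (H : GoodPair a₁ δ B U F) (hA : 0 < A) (hB : 0 < B) :
    GoodPair a₁ δ (A+B) (cv u U) (ratioSeq (A+B) (cv u U)) := by
  have hV : ∀ n, 0 < cv u U n := cv_pos h.pos H.pos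
  have hAB : 0 < A + B := by positivity
  -- main identity
  have key : ∀ (G : ℕ → ℕ → ℝ) (n : ℕ),
      ∑ p ∈ Finset.HasAntidiagonal.antidiagonal (n+1), (f p.1 + F p.2) * G p.1 p.2 * (u p.1 * U p.2)
      = A * ∑ p ∈ Finset.HasAntidiagonal.antidiagonal n, G (p.1+1) p.2 * (u p.1 * U p.2)
       + B * ∑ p ∈ Finset.HasAntidiagonal.antidiagonal n, G p.1 (p.2+1) * (u p.1 * U p.2) := by
    intro G n
    rw [← conv_shift_left u U f A h.f0 h.rcr G n, ← conv_shift_right u U F B H.f0 H.rcr G n,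
      ← Finset.sum_add_distrib]
    refine Finset.sum_congr rfl fun p _ => by ring
  have key1 : ∀ n : ℕ, ∑ p ∈ Finset.HasAntidiagonal.antidiagonal (n+1), (f p.1 + F p.2) * (u p.1 * U p.2)
      = (A+B) * cv u U n := by
    intro n
    have := key (fun _ _ => 1) n
    simp only [mul_one, one_mul] at this
    rw [this, cv]; ring
  have key1' : ∀ n : ℕ, ∑ p ∈ Finset.HasAntidiagonal.antidiagonal n, (f p.1 + F p.2) * (u p.1 * U p.2)
      = ratioSeq (A+B) (cv u U) n * cv u U n := by
    intro n
    cases n with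
    | zero => simp [ratioSeq, h.f0, H.f0]
    | succ n => rw [key1, ratioSeq]; field_simp [(hV (n+1)).ne']
  refine ⟨hV, rfl, ?_, ?_, ?_, ?_⟩
  · intro k
    rw [ratioSeq]; field_simp [(hV (k+1)).ne']
  · intro n
    refine le_of_mul_le_mul_right ?_ (hV n)
    rw [← key1', cv, Finset.mul_sum]
    refine Finset.sum_le_sum fun p hp => ?_
    rw [Finset.HasAntidiagonal.mem_antidiagonal] at hp
    refine mul_le_mul_of_nonneg_right ?_ (mul_pos (h.pos _) (H.pos _)).le
    have h1 := h.lb p.1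
    have h2 := H.lb p.2
    have : (n:ℝ) = p.1 + p.2 := by rw [← hp]; push_cast; ring
    rw [this]; linarith
  · intro n
    refine le_of_mul_le_mul_right ?_ (hV n)
    rw [← key1', cv, Finset.mul_sum]
    refine Finset.sum_le_sum fun p hp => ?_
    rw [Finset.HasAntidiagonal.mem_antidiagonal] at hp
    refine mul_le_mul_of_nonneg_right ?_ (mul_pos (h.pos _) (H.pos _)).le
    have h1 := h.ub p.1
    have h2 := H.ub p.2
    have : (n:ℝ) = p.1 + p.2 := by rw [← hp]; push_cast; ring
    rw [this]; linarith
  · intro n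
    set S : ℕ → ℕ → ℝ := fun k l => f k + F l with hS
    have e1 := key (fun k l => S k l - a₁) n
    -- upper bound of RHS
    have e2 : ∑ p ∈ Finset.HasAntidiagonal.antidiagonal (n+1), (f p.1 + F p.2) * (S p.1 p.2 - a₁) * (u p.1 * U p.2)
        ≤ (A + B) * (ratioSeq (A+B) (cv u U) n * cv u U n) := by
      rw [e1, ← key1' n, add_mul]
      refine add_le_add (mul_le_mul_of_nonneg_left ?_ hA.le) (mul_le_mul_of_nonneg_left ?_ hB.le)
      · refine Finset.sum_le_sum fun p _ => ?_
        refine mul_le_mul_of_nonneg_right ?_ (mul_pos (h.pos _) (H.pos _)).le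
        have := h.lip p.1
        simp only [hS]; linarith
      · refine Finset.sum_le_sum fun p _ => ?_
        refine mul_le_mul_of_nonneg_right ?_ (mul_pos (h.pos _) (H.pos _)).le
        have := H.lip p.2
        simp only [hS]; linarith
    set r := ratioSeq (A+B) (cv u U) (n+1) with hr
    have hrV : (A+B) * cv u U n = r * cv u U (n+1) := by
      rw [hr, ratioSeq]; field_simp [(hV (n+1)).ne']
    have hrpos : 0 < r := by
      rw [hr, ratioSeq]; exact div_pos (mul_pos hAB (hV _)) (hV _)
    -- S (S - a1) ≥ 2 r S - r^2 - a1 S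
    have e3 : ∑ p ∈ Finset.HasAntidiagonal.antidiagonal (n+1), ((2*r - a₁) * ((f p.1 + F p.2) * (u p.1 * U p.2))
          - r^2 * (u p.1 * U p.2)) ≤
        ∑ p ∈ Finset.HasAntidiagonal.antidiagonal (n+1), (f p.1 + F p.2) * (S p.1 p.2 - a₁) * (u p.1 * U p.2) := by
      refine Finset.sum_le_sum fun p _ => ?_
      have hp := mul_pos (h.pos p.1) (H.pos p.2)
      simp only [hS]
      nlinarith [mul_nonneg hp.le (sq_nonneg (f p.1 + F p.2 - r))]
    rw [Finset.sum_sub_distrib, ← Finset.mul_sum, ← Finset.mul_sum, key1] at e3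
    have e4 : ∑ p ∈ Finset.HasAntidiagonal.antidiagonal (n+1), u p.1 * U p.2 = cv u U (n+1) := rfl
    rw [e4] at e3
    have e5 := e3.trans e2
    -- (2r-a1) (A+B) V n - r * (A+B) V n ≤ (A+B) * R n * V n
    have e6 : r^2 * cv u U (n+1) = r * ((A+B) * cv u U n) := by rw [hrV]; ring
    rw [e6] at e5
    have hpp : 0 < (A+B) * cv u U n := mul_pos hAB (hV n)
    nlinarith

/-- finite partition function on `Λ` -/
def Wf (c : ℕ → ℝ) (Λ : Finset ℤ) (n : ℕ) : ℝ :=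
  ∑ η ∈ Finset.piAntidiag Λ n, ∏ x ∈ Λ, (cfact c (η x))⁻¹

/-- single-site weights -/
def wt (c : ℕ → ℝ) (k : ℕ) : ℝ := (cfact c k)⁻¹

/-- `Vc c L` is the partition function on `L+1` sites -/
def Vc (c : ℕ → ℝ) : ℕ → ℕ → ℝ
  | 0 => wt c
  | L+1 => cv (wt c) (Vc c L)

/-- splitting into two disjoint sets -/
lemma Wf_split (c : ℕ → ℝ) (A B : Finset ℤ) (hAB : Disjoint A B) (n k : ℕ) :
    ∑ η ∈ (Finset.piAntidiag (A ∪ B) (n + k)) with (∑ x ∈ A, η x) = n,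
      ∏ x ∈ A ∪ B, (cfact c (η x))⁻¹ = Wf c A n * Wf c B k := by
  rw [Wf, Wf, Finset.sum_mul_sum, ← Finset.sum_product']
  refine Finset.sum_bij' (fun η _ => (fun x => if x ∈ A then η x else 0, fun x => if x ∈ B then η x else 0))
    (fun p _ => fun x => p.1 x + p.2 x) ?_ ?_ ?_ ?_ ?_
  · intro η hη
    simp only [Finset.mem_filter, Finset.mem_piAntidiag, Finset.mem_product] at hη ⊢
    obtain ⟨⟨h1, h2⟩, h3⟩ := hη
    rw [Finset.sum_union hAB, h3] at h1
    refine ⟨⟨?_, ?_⟩, ?_, ?_⟩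
    · rw [← h3]; exact Finset.sum_congr rfl fun x hx => by simp [hx]
    · intro i hi; by_contra h; simp [h] at hi
    · rw [← Nat.add_left_cancel h1]; exact Finset.sum_congr rfl fun x hx => by simp [hx]
    · intro i hi; by_contra h; simp [h] at hi
  · intro p hp
    simp only [Finset.mem_filter, Finset.mem_piAntidiag, Finset.mem_product] at hp ⊢
    obtain ⟨⟨h1, h2⟩, h3, h4⟩ := hp
    have hA : ∑ x ∈ A, (p.1 x + p.2 x) = n := by
      rw [← h1]; refine Finset.sum_congr rfl fun x hx => ?_
      have : p.2 x = 0 := by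
        by_contra h; exact Finset.disjoint_left.1 hAB hx (h4 x h)
      omega
    have hB : ∑ x ∈ B, (p.1 x + p.2 x) = k := by
      rw [← h3]; refine Finset.sum_congr rfl fun x hx => ?_
      have : p.1 x = 0 := by
        by_contra h; exact Finset.disjoint_left.1 hAB (h2 x h) hx
      omega
    refine ⟨⟨?_, ?_⟩, hA⟩
    · rw [Finset.sum_union hAB, hA, hB]
    · intro i hi
      rw [Finset.mem_union]
      by_contra h
      push Not at h
      have e1 : p.1 i = 0 := by by_contra h'; exact h.1 (h2 i h')
      have e2 : p.2 i = 0 := by by_contra h'; exact h.2 (h4 i h')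
      omega
  · intro η hη
    simp only [Finset.mem_filter, Finset.mem_piAntidiag] at hη
    obtain ⟨⟨h1, h2⟩, h3⟩ := hη
    funext x
    by_cases hA : x ∈ A
    · have hB : x ∉ B := Finset.disjoint_left.1 hAB hA
      simp [hA, hB]
    · by_cases hB : x ∈ B
      · simp [hA, hB]
      · have : η x = 0 := by
          by_contra h; have := h2 x h; simp [hA, hB] at this
        simp [hA, hB, this]
  · intro p hp
    simp only [Finset.mem_piAntidiag, Finset.mem_product] at hp
    obtain ⟨⟨h1, h2⟩, h3, h4⟩ := hp
    ext x
    · by_cases hA : x ∈ A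
      · have : p.2 x = 0 := by
          by_contra h; exact Finset.disjoint_left.1 hAB hA (h4 x h)
        simp [hA, this]
      · have : p.1 x = 0 := by by_contra h; exact hA (h2 x h)
        simp [hA, this]
    · by_cases hB : x ∈ B
      · have : p.1 x = 0 := by
          by_contra h; exact Finset.disjoint_left.1 hAB (h2 x h) hB
        simp [hB, this]
      · have : p.2 x = 0 := by by_contra h; exact hB (h4 x h)
        simp [hB, this]
  · intro η hη
    rw [Finset.prod_union hAB]
    congr 1
    · exact Finset.prod_congr rfl fun x hx => by simp [hx]
    · exact Finset.prod_congr rfl fun x hx => by simp [hx]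

lemma Wf_union (c : ℕ → ℝ) (A B : Finset ℤ) (hAB : Disjoint A B) (N : ℕ) :
    Wf c (A ∪ B) N = cv (Wf c A) (Wf c B) N := by
  have h0 : Wf c (A ∪ B) N = ∑ p ∈ Finset.HasAntidiagonal.antidiagonal N,
      ∑ η ∈ (Finset.piAntidiag (A ∪ B) N) with (∑ x ∈ A, η x, ∑ x ∈ B, η x) = p,
      ∏ x ∈ A ∪ B, (cfact c (η x))⁻¹ := by
    rw [Wf, Finset.sum_fiberwise_of_maps_to]
    intro η hη
    rw [Finset.mem_piAntidiag] at hη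
    simp [← Finset.sum_union hAB, hη.1]
  rw [h0, cv]
  refine Finset.sum_congr rfl fun p hp => ?_
  rw [Finset.HasAntidiagonal.mem_antidiagonal] at hp
  rw [← Wf_split c A B hAB, hp]
  refine Finset.sum_congr ?_ fun _ _ => rfl
  ext η
  simp only [Finset.mem_filter, and_congr_right_iff, Finset.mem_piAntidiag]
  rintro ⟨h1, _⟩
  rw [Finset.sum_union hAB] at h1
  constructor
  · intro h; rw [← h]
  · intro h; ext
    · exact h
    · simp only; omega

lemma Wf_singleton (c : ℕ → ℝ) (x : ℤ) (n : ℕ) : Wf c {x} n = wt c n := by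
  have : Finset.piAntidiag {x} n = {Pi.single x n} := by
    ext η
    simp only [Finset.mem_piAntidiag, Finset.sum_singleton, Finset.mem_singleton]
    constructor
    · rintro ⟨h1, h2⟩
      funext y
      by_cases hy : y = x
      · subst hy; simp [h1]
      · have : η y = 0 := by by_contra h; exact hy (h2 y h)
        simp [hy, this]
    · rintro rfl
      refine ⟨by simp, fun i hi => ?_⟩
      by_contra h; simp [h] at hi
  simp [Wf, this, wt]

lemma Wf_eq (c : ℕ → ℝ) (L : ℕ) : ∀ (Λ : Finset ℤ), Λ.card = L + 1 → ∀ n, Wf c Λ n = Vc c L n := by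
  induction L with
  | zero =>
    intro Λ h n
    obtain ⟨x, rfl⟩ := Finset.card_eq_one.1 (by simpa using h)
    rw [Wf_singleton, Vc]
  | succ L ih =>
    intro Λ h n
    obtain ⟨x, t, hx, rfl, ht⟩ := Finset.card_eq_succ.1 h
    rw [Finset.insert_eq, Wf_union c _ _ (by simpa using hx), Vc]
    have e1 : Wf c {x} = wt c := funext (Wf_singleton c x)
    have e2 : Wf c t = Vc c L := funext (ih t ht)
    rw [e1, e2]

lemma tsum_nuW (c : ℕ → ℝ) (Λ : Finset ℤ) (N : ℕ) (f : (ℤ → ℕ) → ℝ) :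
    ∑' η, nuW c Λ N η * f η = ∑ η ∈ Finset.piAntidiag Λ N, (∏ x ∈ Λ, (cfact c (η x))⁻¹) * f η := by
  classical
  have hmem : ∀ η, η ∈ Finset.piAntidiag Λ N ↔ ((∀ x, x ∉ Λ → η x = 0) ∧ (∑ x ∈ Λ, η x) = N) := by
    intro η
    rw [Finset.mem_piAntidiag, and_comm]
    refine and_congr_left fun _ => forall_congr' fun x => ?_
    tauto
  rw [tsum_eq_sum (s := Finset.piAntidiag Λ N)]
  · refine Finset.sum_congr rfl fun η hη => ?_
    rw [nuW, Set.indicator_of_mem]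
    exact (hmem η).1 hη
  · intro η hη
    rw [nuW, Set.indicator_of_notMem, zero_mul]
    exact fun h => hη ((hmem η).2 h)

lemma gammaP_eq (c : ℕ → ℝ) (a : ℤ) (L N n : ℕ) (hn : n ≤ N) :
    gammaP c a (L+1) N n = Vc c L n * Vc c L (N - n) / cv (Vc c L) (Vc c L) N := by
  have hdis : Disjoint (seg1 a (L+1)) (seg2 a (L+1)) := by
    rw [Finset.disjoint_left]; intro x h1 h2
    simp only [seg1, seg2, Finset.mem_Ico] at h1 h2; omega
  have hun : segL a (L+1) = seg1 a (L+1) ∪ seg2 a (L+1) := by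
    ext x; simp only [segL, seg1, seg2, Finset.mem_Ico, Finset.mem_union]; push_cast; omega
  have h1 : Wf c (seg1 a (L+1)) = Vc c L := funext (Wf_eq c L _ (by simp [seg1]))
  have h2 : Wf c (seg2 a (L+1)) = Vc c L := funext (Wf_eq c L _ (by simp [seg2]; omega))
  rw [gammaP, wE]
  congr 1
  · rw [tsum_nuW, ← h1]
    nth_rewrite 2 [h1]
    rw [← h2, ← Wf_split c _ _ hdis, ← hun, Nat.add_sub_cancel' hn, Finset.sum_filter]
    refine Finset.sum_congr rfl fun η _ => ?_
    by_cases h : ∑ x ∈ seg1 a (L+1), η x = n <;> simp [Set.indicator, h]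
  · have := tsum_nuW c (segL a (L+1)) N (fun _ => 1)
    simp only [mul_one] at this
    rw [this, hun]
    have h3 := Wf_union c _ _ hdis N
    rw [h1, h2] at h3
    rw [← h3, Wf]

lemma cv_eq_range (u U : ℕ → ℝ) (N : ℕ) : cv u U N = ∑ n ∈ Finset.range (N+1), u n * U (N - n) := by
  rw [cv, Finset.Nat.sum_antidiagonal_eq_sum_range_succ (fun i j => u i * U j)]

/-- super-exponential decay -/
def Decay (V : ℕ → ℝ) : Prop :=
  (∀ n, 0 ≤ V n) ∧ ∃ D B : ℝ, 0 ≤ D ∧ 0 ≤ B ∧ ∀ n : ℕ, V n ≤ D * (B ^ n / (n.factorial : ℝ))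

lemma GoodPair.decay {a₁ δ A : ℝ} {u f : ℕ → ℝ} (h : GoodPair a₁ δ A u f) (hδ : 0 < δ) (hA : 0 < A) :
    Decay u := by
  refine ⟨fun n => (h.pos n).le, u 0, A / δ, (h.pos 0).le, by positivity, fun n => ?_⟩
  induction n with
  | zero => simp
  | succ n ih =>
    have h1 := h.rcr n
    have h2 := h.lb (n+1)
    have hp : (0:ℝ) < ((n+1 : ℕ) : ℝ) := by positivity
    have h3 : δ * ((n+1 : ℕ):ℝ) * u (n+1) ≤ A * u n := by
      rw [← h1]; exact mul_le_mul_of_nonneg_right h2 (h.pos _).le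
    have h4 : u (n+1) ≤ A / δ / ((n+1:ℕ):ℝ) * u n := by
      rw [div_div, div_mul_eq_mul_div, le_div_iff₀ (by positivity)]; linarith
    refine h4.trans ((mul_le_mul_of_nonneg_left ih (by positivity)).trans (le_of_eq ?_))
    rw [Nat.factorial_succ, pow_succ]; push_cast
    field_simp

/-- unnormalised expectation -/
def Ex (V : ℕ → ℝ) (θ : ℝ) (f : ℕ → ℝ) : ℝ := ∑' n : ℕ, f n * (V n * Real.exp (n * θ))

lemma Decay.summ {V : ℕ → ℝ} (h : Decay V) (θ : ℝ) {f : ℕ → ℝ} {B : ℝ}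
    (hf : ∀ n : ℕ, |f n| ≤ B * Real.exp n) : Summable fun n : ℕ => f n * (V n * Real.exp (n * θ)) := by
  obtain ⟨h0, D, b, hD, hb, hV⟩ := h
  have hB : 0 ≤ B := by
    have := (abs_nonneg _).trans (hf 0)
    simpa using this
  have hs : Summable fun n : ℕ => (B * D) * ((b * Real.exp (θ + 1)) ^ n / (n.factorial : ℝ)) :=
    (Real.summable_pow_div_factorial _).mul_left _
  refine Summable.of_norm_bounded hs fun n => ?_
  rw [Real.norm_eq_abs, abs_mul, abs_of_nonneg (mul_nonneg (h0 n) (Real.exp_pos _).le)]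
  have h1 : V n * Real.exp (n * θ) ≤ D * (b ^ n / (n.factorial : ℝ)) * Real.exp (n * θ) :=
    mul_le_mul_of_nonneg_right (hV n) (Real.exp_pos _).le
  refine (mul_le_mul (hf n) h1 (mul_nonneg (h0 n) (Real.exp_pos _).le) (by positivity)).trans
    (le_of_eq ?_)
  have : Real.exp (θ+1) ^ n = Real.exp (n * θ) * Real.exp n := by
    rw [← Real.exp_nat_mul, ← Real.exp_add]; ring_nf
  rw [mul_pow, this]; ring

lemma nat_le_exp (n : ℕ) : (n:ℝ) ≤ Real.exp n := by
  have := Real.add_one_le_exp (n:ℝ); linarith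

lemma nat_sq_le_exp (n : ℕ) : (n:ℝ)^2 ≤ 2 * Real.exp n := by
  have := Real.quadratic_le_exp_of_nonneg (Nat.cast_nonneg (α := ℝ) n)
  have : (0:ℝ) ≤ n := Nat.cast_nonneg n
  linarith

lemma one_le_exp_nat (n : ℕ) : (1:ℝ) ≤ Real.exp n := by
  have := Real.add_one_le_exp (n:ℝ); have : (0:ℝ) ≤ n := Nat.cast_nonneg n; linarith

lemma bd0 : ∀ n : ℕ, |(1:ℝ)| ≤ 1 * Real.exp n := fun n => by
  rw [abs_one, one_mul]; exact one_le_exp_nat n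
lemma bd1 : ∀ n : ℕ, |(n:ℝ)| ≤ 1 * Real.exp n := fun n => by
  rw [Nat.abs_cast, one_mul]; exact nat_le_exp n
lemma bd2 : ∀ n : ℕ, |(n:ℝ)^2| ≤ 2 * Real.exp n := fun n => by
  rw [abs_of_nonneg (by positivity)]; exact nat_sq_le_exp n

lemma Decay.hasDeriv {V : ℕ → ℝ} (h : Decay V) (θ : ℝ) {f : ℕ → ℝ} {B B' : ℝ}
    (hf : ∀ n : ℕ, |f n| ≤ B * Real.exp n) (hf' : ∀ n : ℕ, |f n * n| ≤ B' * Real.exp n) :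
    HasDerivAt (fun θ => Ex V θ f) (Ex V θ (fun n => f n * n)) θ := by
  refine hasDerivAt_tsum_of_isPreconnected (u := fun n : ℕ => |f n * n| * (V n * Real.exp (n * (θ+1))))
    (t := Set.Iio (θ+1)) (y₀ := θ) (g := fun n θ => f n * (V n * Real.exp (n * θ)))
    (g' := fun n θ => f n * n * (V n * Real.exp (n * θ)))
    ?_ isOpen_Iio isPreconnected_Iio ?_ ?_ ?_ ?_ ?_
  · exact h.summ (θ+1) (f := fun n => |f n * n|) (B := B') (fun n => by rw [abs_abs]; exact hf' n)
  · intro n y _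
    have h1 : HasDerivAt (fun y : ℝ => (n:ℝ) * y) (n:ℝ) y := by
      simpa using (hasDerivAt_id y).const_mul (n:ℝ)
    have h2 := ((h1.exp).const_mul (V n)).const_mul (f n)
    refine h2.congr_deriv ?_
    ring
  · intro n y hy
    rw [Real.norm_eq_abs, abs_mul, abs_of_nonneg (mul_nonneg (h.1 n) (Real.exp_pos _).le)]
    refine mul_le_mul_of_nonneg_left (mul_le_mul_of_nonneg_left (Real.exp_le_exp.2 ?_) (h.1 n)) (abs_nonneg _)
    exact mul_le_mul_of_nonneg_left (le_of_lt hy) (Nat.cast_nonneg n)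
  · simp
  · exact h.summ θ hf
  · simp

/-- product formula -/
lemma Ex_conv {u U : ℕ → ℝ} (hu : Decay u) (hU : Decay U) (θ : ℝ) {f g : ℕ → ℝ} {B B' : ℝ}
    (hf : ∀ n : ℕ, |f n| ≤ B * Real.exp n) (hg : ∀ n : ℕ, |g n| ≤ B' * Real.exp n) :
    HasSum (fun n : ℕ => (∑ p ∈ Finset.HasAntidiagonal.antidiagonal n, f p.1 * g p.2 * (u p.1 * U p.2))
      * Real.exp (n * θ)) (Ex u θ f * Ex U θ g) := by
  have s1 := (hu.summ θ hf).norm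
  have s2 := (hU.summ θ hg).norm
  have e := tsum_mul_tsum_eq_tsum_sum_antidiagonal_of_summable_norm s1 s2
  have s := (summable_norm_sum_mul_antidiagonal_of_summable_norm s1 s2).of_norm
  have := s.hasSum
  rw [← e] at this
  refine this.congr_fun ?_
  intro n
  rw [Finset.sum_mul]
  refine Finset.sum_congr rfl fun p hp => ?_
  rw [Finset.HasAntidiagonal.mem_antidiagonal] at hp
  have : Real.exp (n * θ) = Real.exp (p.1 * θ) * Real.exp (p.2 * θ) := by
    rw [← Real.exp_add, ← hp]; push_cast; ring_nf
  rw [this]; ring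

/-- mean and variance of the tilted measure -/
structure Mom (V : ℕ → ℝ) (θ M v : ℝ) : Prop where
  pos : 0 < Ex V θ (fun _ => 1)
  one : Ex V θ (fun n => (n:ℝ)) = M * Ex V θ (fun _ => 1)
  two : Ex V θ (fun n => (n:ℝ)^2) = (v + M^2) * Ex V θ (fun _ => 1)

lemma Mom.conv {u U : ℕ → ℝ} (hu : Decay u) (hU : Decay U) {θ M v M' v' : ℝ}
    (h : Mom u θ M v) (h' : Mom U θ M' v') : Mom (cv u U) θ (M+M') (v+v') := by
  have e0 : Ex (cv u U) θ (fun _ => 1) = Ex u θ (fun _ => 1) * Ex U θ (fun _ => 1) := by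
    refine HasSum.tsum_eq ((Ex_conv hu hU θ bd0 bd0).congr_fun fun n => ?_)
    simp [cv]
  refine ⟨?_, ?_, ?_⟩
  · rw [e0]; exact mul_pos h.pos h'.pos
  · have : Ex (cv u U) θ (fun n => (n:ℝ)) = Ex u θ (fun n => (n:ℝ)) * Ex U θ (fun _ => 1)
        + Ex u θ (fun _ => 1) * Ex U θ (fun n => (n:ℝ)) := by
      refine HasSum.tsum_eq (((Ex_conv hu hU θ bd1 bd0).add (Ex_conv hu hU θ bd0 bd1)).congr_fun
        fun n => ?_)
      rw [← add_mul, ← Finset.sum_add_distrib, cv, ← mul_assoc, Finset.mul_sum]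
      congr 1
      refine Finset.sum_congr rfl fun p hp => ?_
      rw [Finset.HasAntidiagonal.mem_antidiagonal] at hp
      rw [← hp]; push_cast; ring
    rw [this, e0, h.one, h'.one]; ring
  · have : Ex (cv u U) θ (fun n => (n:ℝ)^2) = (Ex u θ (fun n => (n:ℝ)^2) * Ex U θ (fun _ => 1)
        + Ex u θ (fun _ => 1) * Ex U θ (fun n => (n:ℝ)^2))
        + 2 * (Ex u θ (fun n => (n:ℝ)) * Ex U θ (fun n => (n:ℝ))) := by
      refine HasSum.tsum_eq ((((Ex_conv hu hU θ bd2 bd0).add (Ex_conv hu hU θ bd0 bd2)).add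
        ((Ex_conv hu hU θ bd1 bd1).mul_left 2)).congr_fun fun n => ?_)
      rw [← add_mul, ← Finset.sum_add_distrib, ← mul_assoc (2:ℝ), ← add_mul, Finset.mul_sum,
        ← Finset.sum_add_distrib, cv, ← mul_assoc, Finset.mul_sum]
      congr 1
      refine Finset.sum_congr rfl fun p hp => ?_
      rw [Finset.HasAntidiagonal.mem_antidiagonal] at hp
      rw [← hp]; push_cast; ring
    rw [this, e0, h.one, h'.one, h.two, h'.two]; ring

lemma Decay.ex_pos {V : ℕ → ℝ} (h : Decay V) (hV : ∀ n, 0 < V n) (θ : ℝ) :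
    0 < Ex V θ (fun _ => 1) := by
  refine (h.summ θ bd0).tsum_pos (fun n => ?_) 0 ?_
  · have := h.1 n; positivity
  · have := hV 0; positivity

lemma Decay.ex_add {V : ℕ → ℝ} (h : Decay V) (θ : ℝ) {f g : ℕ → ℝ} {B B' : ℝ}
    (hf : ∀ n : ℕ, |f n| ≤ B * Real.exp n) (hg : ∀ n : ℕ, |g n| ≤ B' * Real.exp n) :
    Ex V θ (fun n => f n + g n) = Ex V θ f + Ex V θ g := by
  rw [Ex, Ex, Ex, ← (h.summ θ hf).tsum_add (h.summ θ hg)]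
  exact tsum_congr fun n => by ring

lemma ex_smul {V : ℕ → ℝ} (θ : ℝ) (f : ℕ → ℝ) (a : ℝ) :
    Ex V θ (fun n => a * f n) = a * Ex V θ f := by
  rw [Ex, Ex, ← tsum_mul_left]
  exact tsum_congr fun n => by ring

lemma Decay.ex_mono {V : ℕ → ℝ} (h : Decay V) (θ : ℝ) {f g : ℕ → ℝ} {B B' : ℝ}
    (hf : ∀ n : ℕ, |f n| ≤ B * Real.exp n) (hg : ∀ n : ℕ, |g n| ≤ B' * Real.exp n)
    (hfg : ∀ n, f n ≤ g n) : Ex V θ f ≤ Ex V θ g := by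
  refine (h.summ θ hf).tsum_le_tsum (fun n => ?_) (h.summ θ hg)
  exact mul_le_mul_of_nonneg_right (hfg n) (mul_nonneg (h.1 n) (Real.exp_pos _).le)

/-- Stein identity -/
lemma GoodPair.stein {a₁ δ A : ℝ} {u f : ℕ → ℝ} (h : GoodPair a₁ δ A u f) (hd : Decay u) (θ : ℝ)
    (g : ℕ → ℝ) {B : ℝ} (hg : ∀ n : ℕ, |f n * g n| ≤ B * Real.exp n) :
    Ex u θ (fun n => f n * g n) = A * Real.exp θ * Ex u θ (fun n => g (n+1)) := by
  rw [Ex, (hd.summ θ hg).tsum_eq_zero_add, h.f0, Ex, ← tsum_mul_left]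
  simp only [zero_mul, zero_add]
  refine tsum_congr fun n => ?_
  have : Real.exp ((n+1 : ℕ) * θ) = Real.exp θ * Real.exp (n * θ) := by
    rw [← Real.exp_add]; push_cast; ring_nf
  rw [this]
  linear_combination (g (n+1) * Real.exp θ * Real.exp (n*θ)) * h.rcr n

lemma Mom.sq {V : ℕ → ℝ} (h : Decay V) {θ M v : ℝ} (hm : Mom V θ M v) (x : ℝ) :
    Ex V θ (fun n => ((n:ℝ) - x)^2) = (v + (M-x)^2) * Ex V θ (fun _ => 1) := by
  have s0 := h.summ θ bd0
  have s1 := h.summ θ bd1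
  have s2 := h.summ θ bd2
  have : Ex V θ (fun n => ((n:ℝ) - x)^2) = Ex V θ (fun n => (n:ℝ)^2) + (-2*x) * Ex V θ (fun n => (n:ℝ))
      + x^2 * Ex V θ (fun _ => 1) := by
    refine HasSum.tsum_eq (((s2.hasSum.add (s1.hasSum.mul_left (-2*x))).add
      (s0.hasSum.mul_left (x^2))).congr_fun fun n => ?_)
    ring
  rw [this, hm.one, hm.two]; ring

lemma bdsq (x : ℝ) (n : ℕ) : |((n:ℝ)-x)^2| ≤ (4 + 2 * x^2) * Real.exp n := by
  rw [abs_of_nonneg (sq_nonneg _)]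
  have h1 := nat_sq_le_exp n
  have h2 := one_le_exp_nat n
  nlinarith [sq_nonneg ((n:ℝ)+x), mul_le_mul_of_nonneg_left h2 (sq_nonneg x)]

lemma Mom.var_nonneg {V : ℕ → ℝ} (h : Decay V) {θ M v : ℝ} (hm : Mom V θ M v) : 0 ≤ v := by
  have h1 := hm.sq h M
  have h2 : 0 ≤ Ex V θ (fun n => ((n:ℝ) - M)^2) := tsum_nonneg fun n =>
    mul_nonneg (sq_nonneg _) (mul_nonneg (h.1 n) (Real.exp_pos _).le)
  rw [h1] at h2
  have := nonneg_of_mul_nonneg_left h2 hm.pos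
  simpa using this

lemma GoodPair.nonneg {a₁ δ A : ℝ} {u f : ℕ → ℝ} (h : GoodPair a₁ δ A u f) (hδ : 0 < δ) (n : ℕ) :
    0 ≤ f n := le_trans (by positivity) (h.lb n)

lemma GoodPair.a_ge {a₁ δ A : ℝ} {u f : ℕ → ℝ} (h : GoodPair a₁ δ A u f) : δ ≤ a₁ := by
  have h1 := h.lb 1
  have h2 := h.ub 1
  simp at h1 h2; linarith

lemma GoodPair.bdf {a₁ δ A : ℝ} {u f : ℕ → ℝ} (h : GoodPair a₁ δ A u f) (hδ : 0 < δ) (n : ℕ) :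
    |f n| ≤ a₁ * Real.exp n := by
  have ha : 0 < a₁ := lt_of_lt_of_le hδ h.a_ge
  rw [abs_of_nonneg (h.nonneg hδ n)]
  exact (h.ub n).trans (mul_le_mul_of_nonneg_left (nat_le_exp n) ha.le)

lemma GoodPair.bdfn {a₁ δ A : ℝ} {u f : ℕ → ℝ} (h : GoodPair a₁ δ A u f) (hδ : 0 < δ) (n : ℕ) :
    |f n * n| ≤ (2*a₁) * Real.exp n := by
  have ha : 0 < a₁ := lt_of_lt_of_le hδ h.a_ge
  have hn : (0:ℝ) ≤ n := Nat.cast_nonneg n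
  rw [abs_of_nonneg (mul_nonneg (h.nonneg hδ n) hn)]
  have h1 := mul_le_mul_of_nonneg_right (h.ub n) hn
  have h2 := mul_le_mul_of_nonneg_left (nat_sq_le_exp n) ha.le
  nlinarith

lemma GoodPair.bdff {a₁ δ A : ℝ} {u f : ℕ → ℝ} (h : GoodPair a₁ δ A u f) (hδ : 0 < δ) (n : ℕ) :
    |f n * f n| ≤ (2*a₁^2) * Real.exp n := by
  have ha : 0 < a₁ := lt_of_lt_of_le hδ h.a_ge
  have hn : (0:ℝ) ≤ n := Nat.cast_nonneg n
  have h0 := h.nonneg hδ n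
  rw [abs_of_nonneg (mul_nonneg h0 h0)]
  have h1 := mul_le_mul (h.ub n) (h.ub n) h0 (by positivity)
  have h2 := mul_le_mul_of_nonneg_left (nat_sq_le_exp n) (sq_nonneg a₁)
  nlinarith

lemma GoodPair.ex_f {a₁ δ A : ℝ} {u f : ℕ → ℝ} (h : GoodPair a₁ δ A u f) (hδ : 0 < δ)
    (hd : Decay u) (θ : ℝ) : Ex u θ f = A * Real.exp θ * Ex u θ (fun _ => 1) := by
  have := h.stein hd θ (fun _ => 1) (B := a₁) (fun n => by simpa using h.bdf hδ n)
  simpa using this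

lemma GoodPair.mean_bounds {a₁ δ A : ℝ} {u f : ℕ → ℝ} (h : GoodPair a₁ δ A u f) (hδ : 0 < δ)
    (hd : Decay u) {θ M v : ℝ} (hm : Mom u θ M v) :
    δ * M ≤ A * Real.exp θ ∧ A * Real.exp θ ≤ a₁ * M := by
  have e := h.ex_f hδ hd θ
  constructor
  · refine le_of_mul_le_mul_right ?_ hm.pos
    rw [← e, mul_assoc, ← hm.one, ← ex_smul]
    refine hd.ex_mono θ (B := δ) (fun n => ?_) (h.bdf hδ) h.lb
    rw [abs_of_nonneg (by positivity)]
    exact mul_le_mul_of_nonneg_left (nat_le_exp n) hδ.le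
  · refine le_of_mul_le_mul_right ?_ hm.pos
    rw [← e, mul_assoc, ← hm.one, ← ex_smul]
    have ha : 0 < a₁ := lt_of_lt_of_le hδ h.a_ge
    refine hd.ex_mono θ (B' := a₁) (h.bdf hδ) (fun n => ?_) h.ub
    rw [abs_of_nonneg (by positivity)]
    exact mul_le_mul_of_nonneg_left (nat_le_exp n) ha.le

lemma bdsqf {a₁ δ A : ℝ} {u f : ℕ → ℝ} (h : GoodPair a₁ δ A u f) (hδ : 0 < δ) (x : ℝ) (n : ℕ) :
    |(f n-x)^2| ≤ (4*a₁^2 + 2 * x^2) * Real.exp n := by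
  rw [abs_of_nonneg (sq_nonneg _)]
  have h1 := (le_abs_self _).trans (h.bdff hδ n)
  have h2 := one_le_exp_nat n
  nlinarith [sq_nonneg (f n+x), mul_le_mul_of_nonneg_left h2 (sq_nonneg x)]

/-- variance of `f` under the tilted measure -/
lemma GoodPair.var_f {a₁ δ A : ℝ} {u f : ℕ → ℝ} (h : GoodPair a₁ δ A u f) (hδ : 0 < δ) (hA : 0 < A)
    (hd : Decay u) (θ : ℝ) : Ex u θ (fun n => (f n - A * Real.exp θ)^2)
      ≤ a₁ * (A * Real.exp θ) * Ex u θ (fun _ => 1) := by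
  have ha : 0 < a₁ := lt_of_lt_of_le hδ h.a_ge
  set x := A * Real.exp θ with hx
  have s0 := hd.summ θ bd0
  have s1 := hd.summ θ (h.bdf hδ)
  have s2 := hd.summ θ (h.bdff hδ)
  have e : Ex u θ (fun n => (f n - x)^2) = Ex u θ (fun n => f n * f n) + (-2*x) * Ex u θ f
      + x^2 * Ex u θ (fun _ => 1) := by
    refine HasSum.tsum_eq (((s2.hasSum.add (s1.hasSum.mul_left (-2*x))).add
      (s0.hasSum.mul_left (x^2))).congr_fun fun n => ?_)
    ring
  have e1 := h.ex_f hδ hd θ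
  have e2 := h.stein hd θ f (h.bdff hδ)
  have e3 : Ex u θ (fun n => f (n+1)) ≤ Ex u θ f + a₁ * Ex u θ (fun _ => 1) := by
    rw [← ex_smul, ← hd.ex_add θ (h.bdf hδ) (g := fun _ => a₁ * 1) (B' := a₁)]
    · have hb : ∀ n : ℕ, |f n + a₁ * 1| ≤ (a₁ + a₁) * Real.exp n := by
        intro n
        have := h.bdf hδ n
        have h2 := mul_le_mul_of_nonneg_left (one_le_exp_nat n) ha.le
        rw [abs_of_nonneg (h.nonneg hδ n)] at this
        rw [abs_of_nonneg (by have := h.nonneg hδ n; positivity)]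
        linarith
      refine hd.ex_mono θ (B := a₁+a₁) (fun n => ?_) hb fun n => ?_
      · refine le_trans ?_ (hb n)
        rw [abs_of_nonneg (h.nonneg hδ _), abs_of_nonneg (by have := h.nonneg hδ n; positivity)]
        have := h.lip n; linarith
      · have := h.lip n; linarith
    · intro n
      have h2 := mul_le_mul_of_nonneg_left (one_le_exp_nat n) ha.le
      rw [abs_of_nonneg (by positivity)]; linarith
  rw [← hx] at e1 e2
  rw [e, e2, e1]
  rw [e1] at e3
  have hxp : 0 < x := by positivity
  nlinarith [mul_le_mul_of_nonneg_left e3 hxp.le]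

/-- concentration inequality without probabilities -/
lemma GoodPair.conc {a₁ δ A : ℝ} {u f : ℕ → ℝ} (h : GoodPair a₁ δ A u f) (hδ : 0 < δ) (hA : 0 < A)
    (hd : Decay u) {θ M v s d : ℝ} (hm : Mom u θ M v) (hs : 0 < s) (hv : v ≤ s^2)
    (hX : ∀ X : ℕ, d^2 ≤ 2 * a₁^2 * ((X:ℝ) - M)^2 + 2 * (f X - A * Real.exp θ)^2 ∨
      4 * s^2 ≤ ((X:ℝ)-M)^2) :
    d^2 ≤ 4/3 * (2 * a₁^2 * v + 2 * (a₁ * (A * Real.exp θ))) := by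
  set x := A * Real.exp θ with hx
  have e1 := hm.sq hd M
  have e2 := h.var_f hδ hA hd θ
  rw [← hx] at e2
  set Z := Ex u θ (fun _ => 1) with hZ
  have hZp : 0 < Z := hm.pos
  have s1 := hd.summ θ (bdsq M)
  have s2 := hd.summ θ (bdsqf h hδ x)
  have s0 := hd.summ θ bd0
  have key : 4 * s^2 * d^2 * Z ≤ (4*s^2*(2*a₁^2) + d^2) * Ex u θ (fun n => ((n:ℝ) - M)^2)
      + 4*s^2*2 * Ex u θ (fun n => (f n - x)^2) := by
    rw [hZ, Ex, Ex, Ex, ← tsum_mul_left, ← tsum_mul_left, ← tsum_mul_left,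
      ← (s1.mul_left _).tsum_add (s2.mul_left _)]
    refine (s0.mul_left _).tsum_le_tsum (fun n => ?_) ((s1.mul_left _).add (s2.mul_left _))
    have hw : 0 ≤ u n * Real.exp (n*θ) := mul_nonneg (hd.1 n) (Real.exp_pos _).le
    have hp : 4 * s^2 * d^2 ≤ (4*s^2*(2*a₁^2) + d^2) * ((n:ℝ) - M)^2 + 4*s^2*2 * (f n - x)^2 := by
      rcases hX n with h1 | h1
      · have := mul_le_mul_of_nonneg_left h1 (by positivity : 0 ≤ 4 * s^2)
        nlinarith [mul_nonneg (sq_nonneg d) (sq_nonneg ((n:ℝ)-M))]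
      · have := mul_le_mul_of_nonneg_left h1 (sq_nonneg d)
        have h3 : 0 ≤ 4*s^2*(2*a₁^2) * ((n:ℝ) - M)^2 + 4*s^2*2 * (f n - x)^2 := by positivity
        nlinarith
    have := mul_le_mul_of_nonneg_right hp hw
    linarith
  rw [e1] at key
  have k2 := mul_le_mul_of_nonneg_left e2 (by positivity : 0 ≤ 4*s^2*2)
  have k3 : (4 * s^2 * d^2) * Z ≤ ((4*s^2*(2*a₁^2) + d^2) * v + 4*s^2*2*(a₁*x)) * Z := by
    have : (M-M) = 0 := by ring
    rw [this] at key
    nlinarith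
  have k4 := le_of_mul_le_mul_right k3 hZp
  have k5 := mul_le_mul_of_nonneg_left hv (sq_nonneg d)
  have hs2 : 0 < s^2 := by positivity
  have k6 : s^2 * (3 * d^2) ≤ s^2 * (4 * (2 * a₁^2 * v + 2 * (a₁ * x))) := by nlinarith
  have := le_of_mul_le_mul_left k6 hs2
  linarith

lemma GoodPair.lip' {a₁ δ A : ℝ} {u f : ℕ → ℝ} (h : GoodPair a₁ δ A u f) (n m : ℕ) :
    f (n+m) ≤ f n + a₁ * m := by
  induction m with
  | zero => simp
  | succ m ih => have := h.lip (n+m); push_cast; rw [← add_assoc]; linarith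

/-- lower estimate of `f n` -/
lemma GoodPair.low {a₁ δ A : ℝ} {u f : ℕ → ℝ} (h : GoodPair a₁ δ A u f) (hδ : 0 < δ) (hA : 0 < A)
    (hd : Decay u) {θ M v s Q : ℝ} (hm : Mom u θ M v) (hs : 0 < s) (hv : v ≤ s^2) (n : ℕ)
    (hM : n + 2 * s ≤ M) (hQ0 : 0 ≤ Q)
    (hQ : 4/3 * (2 * a₁^2 * v + 2 * (a₁ * (A * Real.exp θ))) ≤ Q^2) :
    (a₁ * n - f n) - (a₁ * M - A * Real.exp θ) ≤ Q := by
  by_contra hcon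
  push Not at hcon
  have := h.conc hδ hA hd (d := (a₁ * n - f n) - (a₁ * M - A * Real.exp θ)) hm hs hv ?_
  · nlinarith
  · intro X
    by_cases hX : n ≤ X
    · left
      obtain ⟨m, rfl⟩ := Nat.exists_eq_add_of_le hX
      have h1 := h.lip' n m
      have h2 : (a₁ * n - f n) - (a₁ * M - A * Real.exp θ) ≤
         a₁ * (((n+m:ℕ):ℝ) - M) - (f (n+m) - A * Real.exp θ) := by push_cast; linarith
      have h3 : 0 ≤ (a₁ * n - f n) - (a₁ * M - A * Real.exp θ) := by linarith
      have h4 := mul_self_le_mul_self h3 h2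
      nlinarith [sq_nonneg (a₁ * (((n+m:ℕ):ℝ) - M) + (f (n+m) - A * Real.exp θ))]
    · right
      push Not at hX
      have : (X:ℝ) ≤ n := by exact_mod_cast hX.le
      nlinarith

lemma GoodPair.upp {a₁ δ A : ℝ} {u f : ℕ → ℝ} (h : GoodPair a₁ δ A u f) (hδ : 0 < δ) (hA : 0 < A)
    (hd : Decay u) {θ M v s Q : ℝ} (hm : Mom u θ M v) (hs : 0 < s) (hv : v ≤ s^2) (n : ℕ)
    (hM : M ≤ n - 2 * s) (hQ0 : 0 ≤ Q)
    (hQ : 4/3 * (2 * a₁^2 * v + 2 * (a₁ * (A * Real.exp θ))) ≤ Q^2) :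
    (a₁ * M - A * Real.exp θ) - (a₁ * n - f n) ≤ Q := by
  by_contra hcon
  push Not at hcon
  have := h.conc hδ hA hd (d := (a₁ * M - A * Real.exp θ) - (a₁ * n - f n)) hm hs hv ?_
  · nlinarith
  · intro X
    by_cases hX : X ≤ n
    · left
      obtain ⟨m, rfl⟩ := Nat.exists_eq_add_of_le hX
      have h1 := h.lip' X m
      have h2 : (a₁ * M - A * Real.exp θ) - (a₁ * (X+m:ℕ) - f (X+m)) ≤
         (f X - A * Real.exp θ) - a₁ * ((X:ℝ) - M) := by push_cast; linarith
      have h3 : 0 ≤ (a₁ * M - A * Real.exp θ) - (a₁ * (X+m:ℕ) - f (X+m)) := by linarith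
      have h4 := mul_self_le_mul_self h3 h2
      nlinarith [sq_nonneg (a₁ * ((X:ℝ) - M) + (f X - A * Real.exp θ))]
    · right
      push Not at hX
      have : (n:ℝ) ≤ X := by exact_mod_cast hX.le
      nlinarith

/-- linear growth of increments -/
lemma c_incr (c : ℕ → ℝ) (a₁ a₂ : ℝ) (k₀ : ℕ)
    (hLG : ∀ k : ℕ, |c (k + 1) - c k| ≤ a₁)
    (hk₀ : 0 < k₀) (ha₂ : 0 < a₂)
    (hM : ∀ j k : ℕ, j + k₀ ≤ k → a₂ ≤ c k - c j) :
    ∃ κ K : ℝ, 0 < κ ∧ 0 ≤ K ∧ ∀ x m : ℕ, κ * m - K ≤ c (x + m) - c x := by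
  have ha1 : 0 ≤ a₁ := (abs_nonneg _).trans (hLG 0)
  have hk : (0:ℝ) < k₀ := by exact_mod_cast hk₀
  have h1 : ∀ x q : ℕ, a₂ * q ≤ c (x + k₀ * q) - c x := by
    intro x q
    induction q with
    | zero => simp
    | succ q ih =>
      have := hM (x + k₀ * q) (x + k₀ * (q+1)) (by rw [mul_add]; omega)
      push_cast; linarith
  have h2 : ∀ x r : ℕ, - (a₁ * r) ≤ c (x + r) - c x := by
    intro x r
    induction r with
    | zero => simp
    | succ r ih =>
      have := (abs_le.1 (hLG (x + r))).1
      rw [← add_assoc]; push_cast; linarith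
  refine ⟨a₂ / k₀, a₂ + a₁ * k₀, by positivity, by positivity, fun x m => ?_⟩
  have h3 := h1 x (m / k₀)
  have h4 := h2 (x + k₀ * (m / k₀)) (m % k₀)
  have h5 : x + k₀ * (m / k₀) + m % k₀ = x + m := by rw [add_assoc, Nat.div_add_mod]
  rw [h5] at h4
  have h6 : (m:ℝ) = k₀ * ((m / k₀ : ℕ):ℝ) + ((m % k₀ : ℕ) : ℝ) := by
    exact_mod_cast (Nat.div_add_mod m k₀).symm
  have h7 : ((m % k₀ : ℕ) : ℝ) ≤ k₀ := by exact_mod_cast (Nat.mod_lt m hk₀).le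
  have h8 : a₂ / k₀ * m ≤ a₂ * ((m / k₀ : ℕ):ℝ) + a₂ := by
    have : a₂ / k₀ * m = a₂ * ((m / k₀ : ℕ):ℝ) + a₂ * (((m % k₀ : ℕ) : ℝ) / k₀) := by
      rw [h6]; field_simp
    rw [this]
    have : (((m % k₀ : ℕ) : ℝ) / k₀) ≤ 1 := by rw [div_le_one hk]; exact h7
    nlinarith
  have h9 := mul_le_mul_of_nonneg_left h7 ha1
  linarith

lemma c_quad (c : ℕ → ℝ) {κ K : ℝ} (hκ : 0 < κ) 
    (h : ∀ x m : ℕ, κ * m - K ≤ c (x + m) - c x) (x k : ℕ) :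
    κ/2 * ((k:ℝ)-x)^2 - K^2/(2*κ) ≤ (c k - c x) * ((k:ℝ) - x) := by
  have key : ∀ x m : ℕ, κ/2 * (m:ℝ)^2 - K^2/(2*κ) ≤ (c (x+m) - c x) * (m:ℝ) := by
    intro x m
    have h1 := mul_le_mul_of_nonneg_right (h x m) (Nat.cast_nonneg (α := ℝ) m)
    have h2 : K * m ≤ κ/2*(m:ℝ)^2 + K^2/(2*κ) := by
      have : κ/2*(m:ℝ)^2 + K^2/(2*κ) - K*m = (κ * m - K)^2/(2*κ) := by field_simp; ring
      have h3 : 0 ≤ (κ * m - K)^2/(2*κ) := by positivity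
      linarith
    nlinarith
  rcases le_total x k with hx | hx
  · obtain ⟨m, rfl⟩ := Nat.exists_eq_add_of_le hx
    have := key x m
    push_cast; rw [add_sub_cancel_left]; exact this
  · obtain ⟨m, rfl⟩ := Nat.exists_eq_add_of_le hx
    have := key k m
    push_cast
    have e : ((k:ℝ) - (k + m)) = -m := by ring
    rw [e]; nlinarith

lemma c_lower (c : ℕ → ℝ) (hc0 : c 0 = 0) (hcpos : ∀ n : ℕ, 0 < n → 0 < c n) {κ K : ℝ} (hκ : 0 < κ)
    (h : ∀ x m : ℕ, κ * m - K ≤ c (x + m) - c x) : ∃ δ : ℝ, 0 < δ ∧ ∀ n : ℕ, δ * n ≤ c n := by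
  have h1 : ∀ M : ℕ, ∃ δ : ℝ, 0 < δ ∧ ∀ n : ℕ, n ≤ M → δ * n ≤ c n := by
    intro M
    induction M with
    | zero => exact ⟨1, one_pos, fun n hn => by
        obtain rfl : n = 0 := by omega
        simp [hc0]⟩
    | succ M ih =>
      obtain ⟨δ, hδ, hd⟩ := ih
      have hp := hcpos (M+1) (by omega)
      have hM : (0:ℝ) < ((M+1:ℕ):ℝ) := by positivity
      refine ⟨min δ (c (M+1) / ((M+1:ℕ):ℝ)), lt_min hδ (div_pos hp hM), fun n hn => ?_⟩
      rcases Nat.lt_or_ge n (M+1) with h' | h'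
      · exact (mul_le_mul_of_nonneg_right (min_le_left _ _) (Nat.cast_nonneg n)).trans (hd n (by omega))
      · obtain rfl : n = M+1 := by omega
        refine (mul_le_mul_of_nonneg_right (min_le_right _ _) (Nat.cast_nonneg _)).trans (le_of_eq ?_)
        field_simp
  obtain ⟨M, hM⟩ := exists_nat_gt (2*K/κ)
  obtain ⟨δ, hδ, hd⟩ := h1 M
  refine ⟨min δ (κ/2), lt_min hδ (by positivity), fun n => ?_⟩
  rcases Nat.lt_or_ge M n with h' | h'
  · refine (mul_le_mul_of_nonneg_right (min_le_right _ _) (Nat.cast_nonneg n)).trans ?_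
    have h2 := h 0 n
    rw [zero_add, hc0] at h2
    have h3 : (M:ℝ) < n := by exact_mod_cast h'
    have h4 : 2*K/κ < n := hM.trans h3
    rw [div_lt_iff₀ hκ] at h4
    linarith
  · exact (mul_le_mul_of_nonneg_right (min_le_left _ _) (Nat.cast_nonneg n)).trans (hd n h')

lemma cfact_pos (c : ℕ → ℝ) (hcpos : ∀ n : ℕ, 0 < n → 0 < c n) (k : ℕ) : 0 < cfact c k := by
  induction k with
  | zero => simp [cfact]
  | succ k ih => exact mul_pos ih (hcpos _ (by omega))

lemma good_wt (c : ℕ → ℝ) (a₁ : ℝ) (hc0 : c 0 = 0) (hcpos : ∀ n : ℕ, 0 < n → 0 < c n)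
    (hLG : ∀ k : ℕ, |c (k + 1) - c k| ≤ a₁) {δ : ℝ} (hδ : ∀ n : ℕ, δ * n ≤ c n) :
    GoodPair a₁ δ 1 (wt c) c where
  pos n := inv_pos.2 (cfact_pos c hcpos n)
  f0 := hc0
  rcr k := by
    have h1 := (cfact_pos c hcpos k).ne'
    have h2 := (hcpos (k+1) (by omega)).ne'
    simp only [wt, cfact]; field_simp
  lb := hδ
  ub n := by
    induction n with
    | zero => simp [hc0]
    | succ n ih =>
      have := (abs_le.1 (hLG n)).2
      push_cast; linarith
  lip n := by have := (abs_le.1 (hLG n)).2; linarith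

lemma good_Vc (c : ℕ → ℝ) {a₁ δ : ℝ} (h : GoodPair a₁ δ 1 (wt c) c) (L : ℕ) :
    GoodPair a₁ δ (L+1) (Vc c L) (ratioSeq (L+1) (Vc c L)) := by
  induction L with
  | zero =>
    have e : ratioSeq (((0:ℕ):ℝ)+1) (Vc c 0) = c := by
      funext n
      cases n with
      | zero => simp [ratioSeq, h.f0]
      | succ n =>
        have := h.rcr n
        have hp := (h.pos (n+1)).ne'
        simp only [ratioSeq, Vc]
        field_simp
        push_cast; linarith
    rw [e]
    simpa [Vc] using h
  | succ L ih =>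
    have := h.conv ih one_pos (by positivity)
    have e : (1:ℝ) + (L+1) = ((L+1:ℕ):ℝ)+1 := by push_cast; ring
    rw [e] at this
    exact this

/-- single site mean -/
def rho (c : ℕ → ℝ) (θ : ℝ) : ℝ := Ex (wt c) θ (fun n => (n:ℝ)) / Ex (wt c) θ (fun _ => 1)
/-- single site variance -/
def vari (c : ℕ → ℝ) (θ : ℝ) : ℝ := Ex (wt c) θ (fun n => (n:ℝ)^2) / Ex (wt c) θ (fun _ => 1) - rho c θ ^2

lemma single_mom (c : ℕ → ℝ) {a₁ δ : ℝ} (h : GoodPair a₁ δ 1 (wt c) c) (hδ : 0 < δ) (θ : ℝ) :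
    Mom (wt c) θ (rho c θ) (vari c θ) := by
  have hd := h.decay hδ one_pos
  have hp := hd.ex_pos h.pos θ
  refine ⟨hp, ?_, ?_⟩
  · rw [rho]; field_simp
  · rw [vari]; field_simp; ring

lemma single_deriv (c : ℕ → ℝ) {a₁ δ : ℝ} (h : GoodPair a₁ δ 1 (wt c) c) (hδ : 0 < δ) (θ : ℝ) :
    HasDerivAt (rho c) (vari c θ) θ := by
  have hd := h.decay hδ one_pos
  have hp := hd.ex_pos h.pos θ
  have bd2' : ∀ n : ℕ, |(n:ℝ)*n| ≤ 2 * Real.exp n := fun n => by rw [← pow_two]; exact bd2 n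
  have bd1' : ∀ n : ℕ, |1*(n:ℝ)| ≤ 1 * Real.exp n := fun n => by rw [one_mul]; exact bd1 n
  have h1 := hd.hasDeriv θ bd1 bd2'
  have h0 := hd.hasDeriv θ bd0 bd1'
  have := h1.div h0 hp.ne'
  refine this.congr_deriv ?_
  simp only [one_mul, ← pow_two]
  rw [vari, rho]; field_simp

lemma single_var (c : ℕ → ℝ) {a₁ δ : ℝ} (h : GoodPair a₁ δ 1 (wt c) c) (hδ : 0 < δ) {κ K0 : ℝ}
    (hκ : 0 < κ) (hK0 : 0 ≤ K0)
    (hq : ∀ x k : ℕ, κ * ((k:ℝ)-x)^2 - K0 ≤ (c k - c x) * ((k:ℝ) - x)) (θ : ℝ) :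
    vari c θ ≤ ((1/δ+1)/δ + (2+K0)/κ) * Real.exp θ := by
  have hd := h.decay hδ one_pos
  have hm := single_mom c h hδ θ
  have hp := hm.pos
  obtain ⟨hb1, hb2⟩ := h.mean_bounds hδ hd hm
  rw [one_mul] at hb1 hb2
  have ha : 0 < a₁ := lt_of_lt_of_le hδ h.a_ge
  have hα := Real.exp_pos θ
  set α := Real.exp θ with hαd
  set ρ := rho c θ
  set v := vari c θ
  set Z := Ex (wt c) θ (fun _ => 1) with hZ
  have hρ : 0 ≤ ρ := by
    by_contra hh; push Not at hh
    nlinarith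
  have hv := hm.var_nonneg hd
  have ef := h.ex_f hδ hd θ
  have efn := h.stein hd θ (fun n => (n:ℝ)) (h.bdfn hδ)
  have s0 := hd.summ θ bd0
  have s1 := hd.summ θ bd1
  have e2 : Ex (wt c) θ (fun n => ((n+1:ℕ):ℝ)) = (ρ+1) * Z := by
    have : Ex (wt c) θ (fun n => ((n+1:ℕ):ℝ)) = Ex (wt c) θ (fun n => (n:ℝ)) + Z := by
      refine HasSum.tsum_eq ((s1.hasSum.add s0.hasSum).congr_fun fun n => ?_)
      push_cast; ring
    rw [this, hm.one]; ring
  rw [e2, one_mul] at efn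
  rw [one_mul] at ef
  rcases le_total α 1 with h1 | h1
  · have e3 : δ * ((v + ρ^2) * Z) ≤ α * ((ρ+1)*Z) := by
      rw [← efn, ← hm.two, ← ex_smul]
      refine hd.ex_mono θ (B := 2*δ) (fun n => ?_) (h.bdfn hδ) fun n => ?_
      · rw [abs_mul, abs_of_pos hδ]
        have := mul_le_mul_of_nonneg_left (bd2 n) hδ.le
        linarith
      · have := mul_le_mul_of_nonneg_right (h.lb n) (Nat.cast_nonneg (α := ℝ) n)
        rw [pow_two, ← mul_assoc]; exact this
    have e4 : δ * (v + ρ^2) ≤ α * (ρ+1) := by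
      refine le_of_mul_le_mul_right ?_ hp
      linarith
    have e5 : ρ ≤ 1/δ := by rw [le_div_iff₀ hδ]; linarith
    have e6 : δ * v ≤ α * (1/δ+1) := by
      have := mul_le_mul_of_nonneg_left e5 hα.le
      nlinarith [mul_nonneg hδ.le (sq_nonneg ρ)]
    have e7 : v ≤ (1/δ+1)/δ * α := by
      rw [div_mul_eq_mul_div, le_div_iff₀ hδ]; linarith
    have : 0 ≤ (2+K0)/κ * α := by positivity
    linarith
  · set x0 := ⌊ρ⌋₊ with hx0
    have hx1 : (x0:ℝ) ≤ ρ := Nat.floor_le hρ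
    have hx2 : ρ < x0 + 1 := Nat.lt_floor_add_one ρ
    have e3 : Ex (wt c) θ (fun n => κ * ((n:ℝ)-x0)^2) ≤ Ex (wt c) θ (fun n => (c n - c x0) * ((n:ℝ)-x0) + K0) := by
      have hb1 : ∀ n : ℕ, |c n * n + -(x0:ℝ) * c n + (-(c x0) * n + (c x0 * x0 + K0) * 1)| ≤
          (2*a₁ + x0 * a₁ + (c x0 + (c x0 * x0 + K0))) * Real.exp n := by
        intro n
        have b1 := h.bdfn hδ n
        have b2 := h.bdf hδ n
        have b3 := bd1 n
        have b0 := bd0 n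
        have hx0 : 0 ≤ c x0 := h.nonneg hδ _
        have hxx : (0:ℝ) ≤ x0 := Nat.cast_nonneg _
        refine (abs_add_le _ _).trans ?_
        have c1 := abs_add_le (c n * n) (-(x0:ℝ) * c n)
        have c2 := abs_add_le (-(c x0) * (n:ℝ)) ((c x0 * x0 + K0) * 1)
        rw [abs_mul (-(x0:ℝ)), abs_neg, abs_of_nonneg hxx] at c1
        rw [abs_mul (-(c x0)), abs_mul (c x0 * x0+K0), abs_neg, abs_of_nonneg hx0,
          abs_of_nonneg (a := c x0 * x0 + K0) (by positivity)] at c2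
        have d1 := mul_le_mul_of_nonneg_left b2 hxx
        have d2 := mul_le_mul_of_nonneg_left b3 hx0
        have d3 := mul_le_mul_of_nonneg_left b0 (a := c x0 * x0 + K0) (by positivity)
        linarith
      refine hd.ex_mono θ (B := κ * (4+2*(x0:ℝ)^2))
        (B' := 2*a₁ + x0 * a₁ + (c x0 + (c x0 * x0 + K0))) (fun n => ?_) (fun n => ?_) fun n => ?_
      · rw [abs_mul, abs_of_pos hκ, mul_assoc]
        exact mul_le_mul_of_nonneg_left (bdsq _ n) hκ.le
      · have := hb1 n
        convert this using 2; ring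
      · have := hq x0 n; linarith
    rw [ex_smul, hm.sq hd] at e3
    have e4 : Ex (wt c) θ (fun n => (c n - c x0) * ((n:ℝ)-x0) + K0) =
        (α * (ρ+1) - x0 * α - c x0 * ρ + c x0 * x0 + K0) * Z := by
      have : Ex (wt c) θ (fun n => (c n - c x0) * ((n:ℝ)-x0) + K0) =
          Ex (wt c) θ (fun n => c n * n) + (-(x0:ℝ)) * Ex (wt c) θ c + (-(c x0)) * Ex (wt c) θ (fun n => (n:ℝ))
           + (c x0 * x0 + K0) * Z := by
        have t1 := hd.summ θ (h.bdfn hδ)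
        have t2 := hd.summ θ (h.bdf hδ)
        refine HasSum.tsum_eq ((((t1.hasSum.add (t2.hasSum.mul_left _)).add (s1.hasSum.mul_left _)).add
          (s0.hasSum.mul_left _)).congr_fun fun n => ?_)
        ring
      rw [this, efn, ef, hm.one]; ring
    rw [e4, ← mul_assoc] at e3
    have e5 := le_of_mul_le_mul_right e3 hp
    have hcx : 0 ≤ c x0 := h.nonneg hδ _
    have e6 : κ * v ≤ (2 + K0) * α := by
      nlinarith [mul_nonneg hκ.le (sq_nonneg (ρ-x0)), mul_nonneg hcx (sub_nonneg.2 hx1),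
        mul_nonneg hα.le (sub_nonneg.2 hx2.le), mul_nonneg hK0 (sub_nonneg.2 h1)]
    have e7 : v ≤ (2+K0)/κ * α := by
      rw [div_mul_eq_mul_div, le_div_iff₀ hκ]; linarith
    have : 0 ≤ (1/δ+1)/δ * α := by positivity
    linarith

lemma mom_Vc (c : ℕ → ℝ) {a₁ δ : ℝ} (h : GoodPair a₁ δ 1 (wt c) c) (hδ : 0 < δ) (L : ℕ) (θ : ℝ) :
    Mom (Vc c L) θ ((L+1) * rho c θ) ((L+1) * vari c θ) := by
  induction L with
  | zero => simpa [Vc] using single_mom c h hδ θ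
  | succ L ih =>
    have := Mom.conv (h.decay hδ one_pos) ((good_Vc c h L).decay hδ (by positivity)) (single_mom c h hδ θ) ih
    have e : ∀ x : ℝ, x + (L+1) * x = (((L+1:ℕ):ℝ)+1) * x := by intro x; push_cast; ring
    rw [e, e] at this
    exact this

lemma rho_bounds (c : ℕ → ℝ) {a₁ δ : ℝ} (h : GoodPair a₁ δ 1 (wt c) c) (hδ : 0 < δ) (θ : ℝ) :
    δ * rho c θ ≤ Real.exp θ ∧ Real.exp θ ≤ a₁ * rho c θ := by
  have := h.mean_bounds hδ (h.decay hδ one_pos) (single_mom c h hδ θ)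
  simpa using this

lemma rho_surj (c : ℕ → ℝ) {a₁ δ : ℝ} (h : GoodPair a₁ δ 1 (wt c) c) (hδ : 0 < δ) {t : ℝ} (ht : 0 < t) :
    ∃ θ, rho c θ = t := by
  have ha : 0 < a₁ := lt_of_lt_of_le hδ h.a_ge
  have hc : Continuous (rho c) := continuous_iff_continuousAt.2 fun θ => (single_deriv c h hδ θ).continuousAt
  refine mem_range_of_exists_le_of_exists_ge hc ⟨Real.log (δ*t), ?_⟩ ⟨Real.log (a₁*t), ?_⟩
  · have := (rho_bounds c h hδ (Real.log (δ*t))).1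
    rw [Real.exp_log (by positivity)] at this
    exact le_of_mul_le_mul_left this hδ
  · have := (rho_bounds c h hδ (Real.log (a₁*t))).2
    rw [Real.exp_log (by positivity)] at this
    exact le_of_mul_le_mul_left this ha

lemma rho_incr (c : ℕ → ℝ) {a₁ δ : ℝ} (h : GoodPair a₁ δ 1 (wt c) c) (hδ : 0 < δ) {C₂ : ℝ} (hC : 0 < C₂)
    (hv : ∀ θ, vari c θ ≤ C₂ * Real.exp θ) {θ₁ θ₂ : ℝ} (hlt : rho c θ₁ < rho c θ₂) :
    rho c θ₂ - rho c θ₁ ≤ C₂ * (Real.exp θ₂ - Real.exp θ₁) := by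
  have hd := h.decay hδ one_pos
  have hmono : Monotone fun θ => C₂ * Real.exp θ - rho c θ := by
    have hD : ∀ θ, HasDerivAt (fun θ => C₂ * Real.exp θ - rho c θ) (C₂ * Real.exp θ - vari c θ) θ :=
      fun θ => ((Real.hasDerivAt_exp θ).const_mul C₂).sub (single_deriv c h hδ θ)
    refine monotone_of_deriv_nonneg (fun θ => (hD θ).differentiableAt) fun θ => ?_
    rw [(hD θ).deriv]; linarith [hv θ]
  have hmono2 : Monotone (rho c) := by
    refine monotone_of_deriv_nonneg (fun θ => (single_deriv c h hδ θ).differentiableAt) fun θ => ?_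
    rw [(single_deriv c h hδ θ).deriv]; exact (single_mom c h hδ θ).var_nonneg hd
  rcases le_total θ₁ θ₂ with h' | h'
  · have := hmono h'; simp only at this; linarith
  · exact absurd (hmono2 h') (not_le.2 hlt)

set_option maxHeartbeats 1000000 in
/-- the key increment estimate for the `ℓ`-site function -/
lemma Phi_incr (c : ℕ → ℝ) {a₁ δ : ℝ} (h : GoodPair a₁ δ 1 (wt c) c) (hδ : 0 < δ) {C₂ : ℝ} (hC : 0 < C₂)
    (hv : ∀ θ, vari c θ ≤ C₂ * Real.exp θ) :
    ∃ κ K : ℝ, 0 < κ ∧ 0 ≤ K ∧ ∀ L n m : ℕ, κ * m - K * Real.sqrt (n + m) ≤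
      ratioSeq (L+1) (Vc c L) (n+m) - ratioSeq (L+1) (Vc c L) n := by
  have ha : 0 < a₁ := lt_of_lt_of_le hδ h.a_ge
  set b := C₂ * a₁ with hb
  have hbp : 0 < b := by positivity
  set K₀ := 2*b+1 with hK₀
  have hK₀p : 1 ≤ K₀ := by linarith
  set K₃ := 1 + (4/3)*(2*a₁^2*K₀^2+2*a₁^2*(1+2*K₀)) with hK₃
  have hK₃p : 1 ≤ K₃ := by
    have : 0 ≤ (4/3)*(2*a₁^2*K₀^2+2*a₁^2*(1+2*K₀)) := by positivity
    linarith
  have hK₃s : (4/3)*(2*a₁^2*K₀^2+2*a₁^2*(1+2*K₀)) ≤ K₃^2 := by nlinarith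
  -- upper estimate of the `Q` quantity
  have hsqrt : ∀ n : ℕ, 1 ≤ n → 1 ≤ Real.sqrt n ∧ Real.sqrt n * Real.sqrt n = n := by
    intro n hn
    refine ⟨?_, Real.mul_self_sqrt (Nat.cast_nonneg n)⟩
    rw [Real.one_le_sqrt]; exact_mod_cast hn
  -- common facts
  have common : ∀ (L n : ℕ) (θ : ℝ), 1 ≤ n → (L+1) * rho c θ ≤ n + 2 * (K₀ * Real.sqrt n) →
      (L+1) * vari c θ ≤ (K₀ * Real.sqrt n)^2 ∧
      4/3*(2*a₁^2*((L+1) * vari c θ)+2*(a₁*((L+1)*Real.exp θ))) ≤ (K₃ * Real.sqrt n)^2 := by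
    intro L n θ hn hr
    obtain ⟨r1, r2⟩ := hsqrt n hn
    set r := Real.sqrt n
    have hL : (0:ℝ) < L + 1 := by positivity
    have hρ := rho_bounds c h hδ θ
    have e1 : (L+1) * Real.exp θ ≤ a₁ * (1 + 2*K₀) * (r*r) := by
      have h1 : (L+1) * Real.exp θ ≤ a₁ * ((L+1) * rho c θ) := by nlinarith [hρ.2]
      have h2 : (n:ℝ) + 2 * (K₀ * r) ≤ (1 + 2*K₀) * (r*r) := by
        rw [← r2]; nlinarith [mul_nonneg (by linarith : 0 ≤ K₀) (by nlinarith : 0 ≤ r*r - r)]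
      have h3 := mul_le_mul_of_nonneg_left (hr.trans h2) ha.le
      linarith
    have e2 : (L+1) * vari c θ ≤ b * (1+2*K₀) * (r*r) := by
      have h1 := mul_le_mul_of_nonneg_left (hv θ) hL.le
      have h2 := mul_le_mul_of_nonneg_left e1 hC.le
      rw [hb]; linarith
    have e3 : b * (1+2*K₀) ≤ K₀^2 := by rw [hK₀]; nlinarith
    have hrr : 0 ≤ r * r := mul_self_nonneg r
    have e4 : (L+1) * vari c θ ≤ (K₀ * r)^2 := by
      have := mul_le_mul_of_nonneg_right e3 hrr
      nlinarith
    refine ⟨e4, ?_⟩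
    have e5 := mul_le_mul_of_nonneg_right hK₃s hrr
    have e6 := mul_le_mul_of_nonneg_left e4 (by positivity : 0 ≤ 4/3*(2*a₁^2))
    have e7 := mul_le_mul_of_nonneg_left e1 (by positivity : 0 ≤ 4/3*(2*a₁))
    nlinarith
  set K₄ := 2*a₁*K₀ + K₃ with hK₄
  have hK₄p : 0 < K₄ := by positivity
  set κ := min δ (1/C₂) with hκ
  have hκp : 0 < κ := lt_min hδ (by positivity)
  refine ⟨κ, 2*K₄ + 2*a₁*K₀, hκp, by positivity, fun L n m => ?_⟩
  rcases Nat.eq_zero_or_pos (n+m) with h0 | hpos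
  · obtain ⟨rfl, rfl⟩ : n = 0 ∧ m = 0 := by omega
    simp
  have hL : (0:ℝ) < L + 1 := by positivity
  have hg := good_Vc c h L
  have hd := hg.decay hδ hL
  set Φ := ratioSeq (L+1) (Vc c L) with hΦ
  obtain ⟨r1, r2⟩ := hsqrt (n+m) hpos
  have ecast : (((n+m:ℕ):ℝ)) = (n:ℝ)+m := by push_cast; ring
  rw [← ecast]
  set R := Real.sqrt ((n+m:ℕ):ℝ) with hR
  have hs2 : 0 < K₀ * R := by positivity
  obtain ⟨θ₂, ht2⟩ := rho_surj c h hδ (t := (((n+m:ℕ):ℝ) + 2*(K₀*R))/(L+1)) (by positivity)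
  have ht2' : (L+1) * rho c θ₂ = ((n+m:ℕ):ℝ) + 2*(K₀*R) := by rw [ht2]; field_simp
  obtain ⟨c1, c2⟩ := common L (n+m) θ₂ hpos ht2'.le
  have low := hg.low hδ hL hd (mom_Vc c h hδ L θ₂) hs2 c1 (n+m) ht2'.ge
    (by positivity : 0 ≤ K₃ * R) c2
  rw [ht2'] at low
  have lowΦ : (L+1) * Real.exp θ₂ - K₄ * R ≤ Φ (n+m) := by
    rw [hK₄]; linarith
  have hκδ : κ ≤ δ := min_le_left _ _
  have hκC : κ * C₂ ≤ 1 := by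
    have := mul_le_mul_of_nonneg_right (min_le_right δ (1/C₂)) hC.le
    have e : 1 / C₂ * C₂ = 1 := by field_simp
    rw [e] at this; exact this
  have hm0 : (0:ℝ) ≤ m := Nat.cast_nonneg m
  have hn0 : (0:ℝ) ≤ n := Nat.cast_nonneg n
  have hrn : Real.sqrt n ≤ R := Real.sqrt_le_sqrt (by rw [ecast]; linarith)
  by_cases hns : (n:ℝ) ≤ 2*(K₀*Real.sqrt n)
  · have h1 := hg.ub n
    have h2 : a₁ * n ≤ 2*a₁*K₀*R := by
      have := mul_le_mul_of_nonneg_left hrn (by positivity : 0 ≤ 2*a₁*K₀)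
      have := mul_le_mul_of_nonneg_left hns ha.le
      linarith
    have h3 : δ * ((n:ℝ)+m) ≤ (L+1) * Real.exp θ₂ := by
      have h4 := (rho_bounds c h hδ θ₂).1
      have h5 := mul_le_mul_of_nonneg_left h4 hL.le
      have h6 : δ * ((n:ℝ)+m) ≤ δ * ((L+1) * rho c θ₂) := by
        refine mul_le_mul_of_nonneg_left ?_ hδ.le
        rw [ht2', ecast]; linarith
      linarith
    have h4 := mul_le_mul_of_nonneg_right hκδ hm0
    have h5 : 0 ≤ K₄ * R := by positivity
    have h6 : 0 ≤ δ * n := by positivity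
    nlinarith
  · push Not at hns
    have hn1 : 1 ≤ n := by
      rcases Nat.eq_zero_or_pos n with h' | h'
      · subst h'; simp at hns
      · exact h'
    obtain ⟨q1, q2⟩ := hsqrt n hn1
    set S := Real.sqrt (n:ℝ) with hS
    have hs1 : 0 < K₀ * S := by positivity
    obtain ⟨θ₁, ht1⟩ := rho_surj c h hδ (t := ((n:ℝ) - 2*(K₀*S))/(L+1)) (div_pos (by linarith) hL)
    have ht1' : (L+1) * rho c θ₁ = (n:ℝ) - 2*(K₀*S) := by rw [ht1]; field_simp
    obtain ⟨d1, d2⟩ := common L n θ₁ hn1 (by rw [ht1']; linarith)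
    have upp := hg.upp hδ hL hd (mom_Vc c h hδ L θ₁) hs1 d1 n ht1'.le
      (by positivity : 0 ≤ K₃ * S) d2
    rw [ht1'] at upp
    have uppΦ : Φ n ≤ (L+1) * Real.exp θ₁ + K₄ * S := by
      rw [hK₄]; linarith
    have hlt : rho c θ₁ < rho c θ₂ := by
      refine lt_of_mul_lt_mul_left ?_ hL.le
      rw [ht1', ht2', ecast]; linarith
    have inc := mul_le_mul_of_nonneg_left (rho_incr c h hδ hC hv hlt) hL.le
    have h1 : (m:ℝ) ≤ C₂ * ((L+1) * Real.exp θ₂ - (L+1) * Real.exp θ₁) := by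
      rw [mul_sub, ht1', ht2', ecast] at inc
      linarith
    have h2 : κ * m ≤ (L+1) * Real.exp θ₂ - (L+1) * Real.exp θ₁ := by
      set X := (L+1) * Real.exp θ₂ - (L+1) * Real.exp θ₁ with hX
      have hX0 : 0 ≤ X := by
        by_contra hh; push Not at hh
        nlinarith
      have := mul_le_mul_of_nonneg_left h1 hκp.le
      have := mul_le_mul_of_nonneg_right hκC hX0
      linarith
    have h3 := mul_le_mul_of_nonneg_left hrn hK₄p.le
    have h4 : 0 ≤ 2*a₁*K₀*R := by positivity
    linarith

/-- iterated upper ratio bound -/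
lemma half_iter {N J : ℕ} {r δ₁ K₁ : ℝ} {a : ℕ → ℝ} 
    (hU : ∀ j, j < J → a (j+1) ≤ a j * Real.exp (-(δ₁ * (j+1) / N) + K₁ / r)) (k l : ℕ) (hkl : k + l ≤ J) :
    a (k+l) ≤ a k * Real.exp (-(δ₁ * (k * l + l * (l+1)/2) / N) + K₁ * l / r) := by
  induction l with
  | zero => simp
  | succ l ih =>
    have h1 := hU (k+l) (by omega)
    have h2 := mul_le_mul_of_nonneg_right (ih (by omega)) (Real.exp_pos (-(δ₁ * (((k+l:ℕ):ℝ)+1) / N) + K₁ / r)).le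
    refine (h1.trans h2).trans (le_of_eq ?_)
    rw [mul_assoc, ← Real.exp_add]
    congr 2; push_cast; ring

lemma geom_bound {y : ℝ} (hy : 0 < y) (n : ℕ) : ∑ l ∈ Finset.range n, Real.exp (-(y * l)) ≤ 1 + 1 / y := by
  have hq : Real.exp (-y) < 1 := by rw [Real.exp_lt_one_iff]; linarith
  have e : ∀ l : ℕ, Real.exp (-(y*l)) = Real.exp (-y) ^ l := fun l => by
    rw [← Real.exp_nat_mul]; ring_nf
  simp only [e]
  rw [geom_sum_eq hq.ne]
  have h1 : Real.exp (-y) * (1 + y) ≤ 1 := by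
    have := Real.add_one_le_exp y
    have h2 := mul_le_mul_of_nonneg_left this (Real.exp_pos (-y)).le
    rw [← Real.exp_add] at h2; simp at h2; linarith
  have h2 : 0 < 1 - Real.exp (-y) := by linarith
  have h3 : 0 ≤ Real.exp (-y) ^ n := by positivity
  rw [← neg_div_neg_eq, div_le_iff₀ (by linarith)]
  have : (1 + 1/y) * -(Real.exp (-y) - 1) = 1 + (1 - Real.exp (-y) * (1+y)) / y := by field_simp; ring
  rw [this]
  have : 0 ≤ (1 - Real.exp (-y) * (1+y)) / y := div_nonneg (by linarith) hy.le
  linarith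

/-- tail bound -/
lemma half_tail {N J : ℕ} (hN : 1 ≤ N) (hJ : J ≤ N) {r δ₁ K₁ : ℝ} (hr : r = Real.sqrt N) (hδ₁ : 0 < δ₁) (hK₁ : 0 ≤ K₁)
    {a : ℕ → ℝ} (ha : ∀ j, j ≤ J → 0 < a j)
    (hU : ∀ j, j < J → a (j+1) ≤ a j * Real.exp (-(δ₁ * (j+1) / N) + K₁ / r)) (k : ℕ) (hk : k ≤ J) :
    ∑ j ∈ Finset.Ico k (J+1), a j * (1 + j / r)^2 ≤
      (Real.exp ((K₁+2+δ₁)^2/(2*δ₁)) * (2 + 1/δ₁)) * r * (1 + k/r) * a k := by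
  have hN' : (1:ℝ) ≤ N := by exact_mod_cast hN
  have hr1 : 1 ≤ r := by rw [hr, Real.one_le_sqrt]; exact hN'
  have hrr : r * r = N := by rw [hr]; exact Real.mul_self_sqrt (by linarith)
  have hr0 : 0 < r := by linarith
  set B := (K₁+2+δ₁)^2/(2*δ₁) with hB
  set y := 1 + (k:ℝ)/r with hy
  have hk0 : (0:ℝ) ≤ k / r := by positivity
  have hy1 : 1 ≤ y := by linarith
  rw [Finset.sum_Ico_eq_sum_range]
  have hterm : ∀ l ∈ Finset.range (J+1-k), a (k+l) * (1 + ((k+l:ℕ):ℝ)/r)^2 ≤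
      a k * y^2 * Real.exp B * Real.exp (-(δ₁*y/r * l)) := by
    intro l hl
    have hl' : k + l ≤ J := by have := Finset.mem_range.1 hl; omega
    have h1 := half_iter hU k l hl'
    set x := (l:ℝ)/r with hx
    have hx0 : 0 ≤ x := by positivity
    have h2 : (1 + ((k+l:ℕ):ℝ)/r) ≤ y * Real.exp x := by
      have e : (1 + ((k+l:ℕ):ℝ)/r) = y + x := by rw [hy, hx]; push_cast; ring
      have := Real.add_one_le_exp x
      rw [e]; nlinarith
    have h3 : (1 + ((k+l:ℕ):ℝ)/r)^2 ≤ y^2 * Real.exp (2*x) := by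
      have e : Real.exp (2*x) = Real.exp x ^2 := by rw [← Real.exp_nat_mul]; norm_num
      rw [e, ← mul_pow]
      exact pow_le_pow_left₀ (by positivity) h2 2
    refine (mul_le_mul h1 h3 (by positivity) (mul_nonneg (ha k hk).le (Real.exp_pos _).le)).trans ?_
    have e : a k * Real.exp (-(δ₁ * (k * l + l * (l+1)/2) / N) + K₁ * l / r) * (y^2 * Real.exp (2*x))
       = a k * y^2 * Real.exp (-(δ₁ * (k * l + l * (l+1)/2) / N) + K₁ * l / r + 2*x) := by
      rw [Real.exp_add _ (2*x)]; ring
    rw [e, mul_assoc (a k * y^2), ← Real.exp_add]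
    refine mul_le_mul_of_nonneg_left (Real.exp_le_exp.2 ?_) (mul_nonneg (ha k hk).le (sq_nonneg y))
    have hkl : (k:ℝ) * l / N = (y-1) * x := by rw [hy, hx, ← hrr]; field_simp; ring
    have hll : (l:ℝ)*(l+1)/2/N = x^2/2 + x/(2*r) := by rw [hx, ← hrr]; field_simp
    have e1 : -(δ₁ * (k * l + l * (l+1)/2) / N) + K₁ * l / r + 2*x =
        -(δ₁ * ((y-1)*x)) - δ₁ * (x^2/2 + x/(2*r)) + (K₁ + 2)*x := by
      rw [← hkl, ← hll, hx]; ring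
    have e2 : δ₁*y/r * l = δ₁ * y * x := by rw [hx]; ring
    rw [e1, e2]
    have h4 : 0 ≤ δ₁ * (x/(2*r)) := by positivity
    have h5 : (K₁+2+δ₁) * x - δ₁*x^2/2 ≤ B := by
      have : B - ((K₁+2+δ₁) * x - δ₁*x^2/2) = (K₁+2+δ₁ - δ₁*x)^2/(2*δ₁) := by
        rw [hB]; field_simp; ring
      have h6 : 0 ≤ (K₁+2+δ₁ - δ₁*x)^2/(2*δ₁) := by positivity
      linarith
    nlinarith
  refine (Finset.sum_le_sum hterm).trans ?_
  rw [← Finset.mul_sum]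
  have hg := geom_bound (y := δ₁*y/r) (by positivity) (J+1-k)
  have hak := ha k hk
  refine (mul_le_mul_of_nonneg_left hg (by positivity)).trans ?_
  have h7 : y ≤ 2 * r := by
    have : (k:ℝ) ≤ N := by exact_mod_cast hk.trans hJ
    have : (k:ℝ)/r ≤ r := by rw [div_le_iff₀ hr0]; linarith
    linarith
  have e : a k * y^2 * Real.exp B * (1 + 1/(δ₁*y/r)) = Real.exp B * (y + r/δ₁) * y * a k := by
    field_simp
  rw [e]
  have h8 : y + r/δ₁ ≤ (2+1/δ₁)*r := by
    have : (2+1/δ₁)*r = 2*r + r/δ₁ := by ring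
    linarith
  have h9 := mul_le_mul_of_nonneg_left h8 (by positivity : 0 ≤ Real.exp B * y * a k)
  nlinarith

/-- weighted Hardy inequality -/
lemma half_hardy {N J : ℕ} {r A' : ℝ} (hr : r * r = N)
    {a g : ℕ → ℝ} (ha : ∀ j, j ≤ J → 0 < a j) (hr0 : 0 < r)
    (hT : ∀ k, k < J → ∑ j ∈ Finset.Ico (k+1) (J+1), a j * (1 + j / r)^2 ≤
      A' * r * (1 + ((k+1:ℕ):ℝ)/r) * min (a (k+1)) (a k)) (hg : g 0 = 0) :
    ∑ j ∈ Finset.range (J+1), a j * (1 + j / r)^2 * g j ^2 ≤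
      4 * A'^2 * N * ∑ k ∈ Finset.range J, min (a (k+1)) (a k) * (g (k+1) - g k)^2 := by
  set w : ℕ → ℝ := fun j => a j * (1 + j / r)^2 with hw
  have hsw : ∑ j ∈ Finset.range (J+1), w j * g j ^2 = 
      ∑ k ∈ Finset.range J, (∑ j ∈ Finset.Ico (k+1) (J+1), w j) * (g (k+1)^2 - g k^2) := by
    have e1 : ∀ j, g j ^2 = ∑ k ∈ Finset.range j, (g (k+1)^2 - g k^2) := by
      intro j
      rw [Finset.sum_range_sub (fun k => g k ^2)]; simp [hg]
    calc _ = ∑ j ∈ Finset.range (J+1), ∑ k ∈ Finset.range j, w j * (g (k+1)^2 - g k^2) := by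
          refine Finset.sum_congr rfl fun j _ => ?_
          rw [e1, Finset.mul_sum]
      _ = ∑ k ∈ Finset.range J, ∑ j ∈ Finset.Ico (k+1) (J+1), w j * (g (k+1)^2 - g k^2) := by
          refine Finset.sum_comm' fun x y => ?_
          simp only [Finset.mem_range, Finset.mem_Ico]; omega
      _ = _ := by
          refine Finset.sum_congr rfl fun k _ => ?_
          rw [Finset.sum_mul]
  have hterm : ∀ k ∈ Finset.range J, (∑ j ∈ Finset.Ico (k+1) (J+1), w j) * (g (k+1)^2 - g k^2) ≤
      1/2 * (w (k+1) * g (k+1)^2) + 2 * A'^2 * N * (min (a (k+1)) (a k) * (g (k+1) - g k)^2) := by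
    intro k hk
    have hk' := Finset.mem_range.1 hk
    have hTk := hT k hk'
    have hmu1 : min (a (k+1)) (a k) ≤ a (k+1) := min_le_left _ _
    have hmu0 : 0 < min (a (k+1)) (a k) := lt_min (ha _ (by omega)) (ha _ (by omega))
    set μ := min (a (k+1)) (a k)
    have hT0 : 0 ≤ ∑ j ∈ Finset.Ico (k+1) (J+1), w j := Finset.sum_nonneg fun j hj => by
      have := ha j (by have := Finset.mem_Ico.1 hj; omega)
      positivity
    set T := ∑ j ∈ Finset.Ico (k+1) (J+1), w j
    set y := 1 + ((k+1:ℕ):ℝ)/r with hy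
    have hwk : w (k+1) = a (k+1) * y^2 := by rw [hw]
    set Δ := g (k+1) - g k with hΔ
    have h1 : g (k+1)^2 - g k^2 ≤ 2 * |Δ * g (k+1)| := by
      have := le_abs_self (Δ * g (k+1))
      rw [hΔ] at this ⊢
      nlinarith [sq_nonneg (g (k+1) - g k)]
    have h2 := mul_le_mul_of_nonneg_left h1 hT0
    have h3 : T * (2 * |Δ * g (k+1)|) ≤ A' * r * y * μ * (2 * |Δ * g (k+1)|) :=
      mul_le_mul_of_nonneg_right hTk (by positivity)
    have h4 : A' * r * y * (2 * |Δ * g (k+1)|) ≤ 1/2 * (y^2 * g (k+1)^2) + 2 * A'^2 * N * Δ^2 := by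
      rw [abs_mul, ← hr, ← sq_abs (g (k+1)), ← sq_abs Δ]
      nlinarith [sq_nonneg (y * |g (k+1)| - 2 * (A' * r * |Δ|))]
    have h5 := mul_le_mul_of_nonneg_left h4 hmu0.le
    have h6 := mul_le_mul_of_nonneg_right hmu1 (by positivity : 0 ≤ 1/2 * (y^2 * g (k+1)^2))
    rw [hwk]
    nlinarith
  have hsum := Finset.sum_le_sum hterm
  rw [← hsw, Finset.sum_add_distrib, ← Finset.mul_sum, ← Finset.mul_sum] at hsum
  have e : ∑ j ∈ Finset.range (J+1), w j * g j ^2 = ∑ k ∈ Finset.range J, w (k+1) * g (k+1)^2 := by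
    rw [Finset.sum_range_succ']; simp [hg]
  rw [← e] at hsum
  linarith

/-- pointwise logarithm bound -/
lemma half_point {N J : ℕ} (hN : 1 ≤ N) {r C₃ c0 s : ℝ} (hr : r = Real.sqrt N) (hC₃ : 0 ≤ C₃) (hc0 : 0 < c0)
    {a g : ℕ → ℝ} (ha : ∀ j, j ≤ J → 0 < a j) (hm : c0 ≤ a 0 * r)
    (hLo : ∀ j, j ≤ J → a 0 ≤ a j * Real.exp (C₃ * (j:ℝ)^2 / N))
    (hg : g 0 = 0) (hs : 0 < s)
    (hsD : N * ∑ k ∈ Finset.range J, min (a (k+1)) (a k) * (g (k+1) - g k)^2 ≤ s) (j : ℕ) (hj : j ≤ J) :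
    1 + Real.log (1 + g j^2/s) ≤ (1 + 1/c0 + C₃) * (1 + j/r)^2 := by
  have hN' : (1:ℝ) ≤ N := by exact_mod_cast hN
  have hr1 : 1 ≤ r := by rw [hr, Real.one_le_sqrt]; exact hN'
  have hrr : r * r = N := by rw [hr]; exact Real.mul_self_sqrt (by linarith)
  have hr0 : 0 < r := by linarith
  set x := (j:ℝ)/r with hx
  have hx0 : 0 ≤ x := by positivity
  have hex : C₃ * (j:ℝ)^2/N = C₃ * x^2 := by rw [hx, ← hrr]; field_simp
  set D := ∑ k ∈ Finset.range J, min (a (k+1)) (a k) * (g (k+1) - g k)^2 with hD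
  set E := Real.exp (C₃ * x^2) with hE
  have hE1 : 1 ≤ E := Real.one_le_exp (by positivity)
  have hEp : 0 < E := by linarith
  have h0 : 0 < a 0 := ha 0 (by omega)
  have hlow : ∀ k, k ≤ j → a 0 / E ≤ a k := by
    intro k hk
    rw [div_le_iff₀ hEp]
    refine (hLo k (hk.trans hj)).trans (mul_le_mul_of_nonneg_left ?_ (ha k (hk.trans hj)).le)
    rw [hE, ← hex]
    refine Real.exp_le_exp.2 ?_
    have : (k:ℝ) ≤ j := by exact_mod_cast hk
    gcongr
  have h1 : g j ^2 ≤ j * ∑ k ∈ Finset.range j, (g (k+1) - g k)^2 := by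
    have e : g j = ∑ k ∈ Finset.range j, (g (k+1) - g k) := by
      rw [Finset.sum_range_sub]; simp [hg]
    have := sq_sum_le_card_mul_sum_sq (s := Finset.range j) (f := fun k => g (k+1) - g k)
    rw [← e] at this
    simpa using this
  have h2 : a 0 / E * ∑ k ∈ Finset.range j, (g (k+1) - g k)^2 ≤ D := by
    rw [Finset.mul_sum]
    refine (Finset.sum_le_sum (g := fun k => min (a (k+1)) (a k) * (g (k+1) - g k)^2) fun k hk => ?_).trans ?_
    · have hk' := Finset.mem_range.1 hk
      exact mul_le_mul_of_nonneg_right (le_min (hlow _ (by omega)) (hlow _ (by omega))) (sq_nonneg _)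
    · refine Finset.sum_le_sum_of_subset_of_nonneg (Finset.range_mono hj) fun k hk _ => ?_
      have hk' := Finset.mem_range.1 hk
      exact mul_nonneg (le_min (ha _ (by omega)).le (ha _ (by omega)).le) (sq_nonneg _)
  have h3 : c0 * g j^2 ≤ s * x * E := by
    set S := ∑ k ∈ Finset.range j, (g (k+1) - g k)^2
    have hS : 0 ≤ S := Finset.sum_nonneg fun _ _ => sq_nonneg _
    have h4 : a 0 * S ≤ D * E := by
      rw [div_mul_eq_mul_div, div_le_iff₀ hEp] at h2; exact h2
    have ej : (j:ℝ) = x * r := by rw [hx]; field_simp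
    calc c0 * g j^2 ≤ (a 0 * r) * (j * S) := mul_le_mul hm h1 (sq_nonneg _) (by positivity)
      _ = x * N * (a 0 * S) := by rw [ej, ← hrr]; ring
      _ ≤ x * N * (D * E) := mul_le_mul_of_nonneg_left h4 (by positivity)
      _ = (N * D) * (x * E) := by ring
      _ ≤ s * (x * E) := mul_le_mul_of_nonneg_right hsD (by positivity)
      _ = _ := by ring
  have h4 : g j^2/s ≤ x/c0 * E := by
    rw [div_le_iff₀ hs, div_mul_eq_mul_div, div_mul_eq_mul_div, le_div_iff₀ hc0]
    linarith
  have h5 : 1 + g j^2/s ≤ Real.exp (x/c0 + C₃*x^2) := by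
    rw [Real.exp_add]
    have := Real.add_one_le_exp (x/c0)
    have h6 := mul_le_mul_of_nonneg_right this hEp.le
    linarith
  have h6 : Real.log (1 + g j^2/s) ≤ x/c0 + C₃*x^2 := by
    rw [Real.log_le_iff_le_exp (by positivity)]; exact h5
  have h7 : x / c0 = x * (1/c0) := by ring
  have h8 : 0 < 1/c0 := by positivity
  rw [h7] at h6
  set q := 1/c0
  nlinarith [mul_nonneg h8.le hx0, mul_nonneg h8.le (sq_nonneg x), mul_nonneg hC₃ hx0]

/-- half-line conclusion -/
lemma half_main {N J : ℕ} (hN : 1 ≤ N) (hJ : J ≤ N) {r δ₁ K₁ C₃ c0 s : ℝ} (hr : r = Real.sqrt N)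
    (hδ₁ : 0 < δ₁) (hK₁ : 0 ≤ K₁) (hC₃ : 0 ≤ C₃) (hc0 : 0 < c0)
    {a g : ℕ → ℝ} (ha : ∀ j, j ≤ J → 0 < a j)
    (hU : ∀ j, j < J → a (j+1) ≤ a j * Real.exp (-(δ₁ * (j+1) / N) + K₁ / r)) (hm : c0 ≤ a 0 * r)
    (hLo : ∀ j, j ≤ J → a 0 ≤ a j * Real.exp (C₃ * (j:ℝ)^2 / N))
    (hg : g 0 = 0) (hs : 0 < s)
    (hsD : N * ∑ k ∈ Finset.range J, min (a (k+1)) (a k) * (g (k+1) - g k)^2 ≤ s) :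
    ∑ j ∈ Finset.range (J+1), a j * (g j^2 * (1 + Real.log (1 + g j^2/s))) ≤
      (1 + 1/c0 + C₃) * (4 * ((Real.exp ((K₁+2+δ₁)^2/(2*δ₁)) * (2 + 1/δ₁)) * Real.exp K₁)^2) * 
      (N * ∑ k ∈ Finset.range J, min (a (k+1)) (a k) * (g (k+1) - g k)^2) := by
  have hN' : (1:ℝ) ≤ N := by exact_mod_cast hN
  have hr1 : 1 ≤ r := by rw [hr, Real.one_le_sqrt]; exact hN'
  have hrr : r * r = N := by rw [hr]; exact Real.mul_self_sqrt (by linarith)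
  have hr0 : 0 < r := by linarith
  set A := Real.exp ((K₁+2+δ₁)^2/(2*δ₁)) * (2 + 1/δ₁) with hA
  have hAp : 0 < A := by positivity
  have hT : ∀ k, k < J → ∑ j ∈ Finset.Ico (k+1) (J+1), a j * (1 + j / r)^2 ≤
      (A * Real.exp K₁) * r * (1 + ((k+1:ℕ):ℝ)/r) * min (a (k+1)) (a k) := by
    intro k hk
    refine (half_tail hN hJ hr hδ₁ hK₁ ha hU (k+1) (by omega)).trans ?_
    have h1 : a (k+1) ≤ Real.exp K₁ * min (a (k+1)) (a k) := by
      have hp := ha (k+1) (by omega)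
      have hp0 := ha k (by omega)
      rw [mul_min_of_nonneg _ _ (Real.exp_pos _).le]
      refine le_min ?_ ?_
      · have := Real.one_le_exp hK₁
        nlinarith
      · refine (hU k hk).trans ?_
        rw [mul_comm]
        refine mul_le_mul_of_nonneg_right (Real.exp_le_exp.2 ?_) hp0.le
        have h2 : K₁ / r ≤ K₁ := div_le_self hK₁ hr1
        have h3 : 0 ≤ δ₁ * ((k:ℝ)+1)/N := by positivity
        linarith
    have h2 := mul_le_mul_of_nonneg_left h1 (by positivity : 0 ≤ A * r * (1 + ((k+1:ℕ):ℝ)/r))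
    rw [← hA]
    linarith
  have hH := half_hardy hrr ha hr0 hT hg
  have hC : 0 ≤ 1 + 1/c0 + C₃ := by positivity
  have h1 : ∑ j ∈ Finset.range (J+1), a j * (g j^2 * (1 + Real.log (1 + g j^2/s))) ≤
      (1 + 1/c0 + C₃) * ∑ j ∈ Finset.range (J+1), a j * (1 + j / r)^2 * g j ^2 := by
    rw [Finset.mul_sum]
    refine Finset.sum_le_sum fun j hj => ?_
    have hj' : j ≤ J := by have := Finset.mem_range.1 hj; omega
    have h2 := half_point hN hr hC₃ hc0 ha hm hLo hg hs hsD j hj'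
    have := mul_le_mul_of_nonneg_left h2 (mul_nonneg (ha j hj').le (sq_nonneg (g j)))
    linarith
  refine h1.trans ((mul_le_mul_of_nonneg_left hH hC).trans (le_of_eq ?_))
  ring

lemma scalar_bd {f f0 s : ℝ} (hf : 0 ≤ f) (hf0 : 0 ≤ f0) (hs : 0 < s) :
    f^2 * Real.log (f^2) - f^2 * Real.log (f0^2+s) - f^2 + (f0^2+s) ≤
      112 * ((f-f0)^2 * (1 + Real.log (1 + (f-f0)^2/s))) + 56 * s := by
  set A := f0^2 + s with hA
  have hAp : 0 < A := by positivity
  set g := f - f0 with hg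
  set ℓ := Real.log (1 + g^2/s) with hℓ
  have hq0 : 0 ≤ g^2/s := by positivity
  have hℓ0 : 0 ≤ ℓ := Real.log_nonneg (by linarith)
  have hsl : s * ℓ ≤ g^2 := by
    have h1 : ℓ ≤ g^2/s := by
      have := Real.log_le_sub_one_of_pos (show 0 < 1 + g^2/s by linarith)
      linarith
    have := mul_le_mul_of_nonneg_left h1 hs.le
    rwa [mul_div_cancel₀ _ hs.ne'] at this
  suffices h : f^2 * Real.log (f^2) - f^2 * Real.log A - f^2 + A ≤ 56 * ((g^2+s)*(1+ℓ)) by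
    nlinarith [mul_nonneg (sq_nonneg g) hℓ0]
  set b := Real.sqrt A with hb
  have hb2 : b^2 = A := Real.sq_sqrt hAp.le
  have hbp : 0 < b := Real.sqrt_pos.2 hAp
  have hbf : f0 ≤ b := Real.le_sqrt_of_sq_le (by linarith)
  have hfb : (f-b)^2 ≤ 2*(g^2+s) := by
    have : (b-f0)^2 ≤ s := by nlinarith
    nlinarith [sq_nonneg (g + (b - f0))]
  rcases hf.eq_or_lt with h0 | hfp
  · rw [← h0]
    simp only [ne_eq, OfNat.ofNat_ne_zero, not_false_eq_true, zero_pow, zero_mul, zero_add, sub_self]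
    rw [← h0] at hfb
    nlinarith [mul_nonneg (by positivity : 0 ≤ g^2+s) hℓ0]
  have hF : 0 < f^2 := by positivity
  have elog : f^2 * Real.log (f^2) - f^2 * Real.log A = f^2 * Real.log (f^2/A) := by
    rw [Real.log_div hF.ne' hAp.ne']; ring
  rw [elog]
  by_cases hc : f ≤ 2*b
  · have h1 : Real.log (f^2/A) ≤ f^2/A - 1 := Real.log_le_sub_one_of_pos (by positivity)
    have h2 := mul_le_mul_of_nonneg_left h1 hF.le
    have h3 : f^2 * (f^2/A-1) - f^2 + A = (f-b)^2*((f+b)^2/A) := by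
      rw [← hb2]; field_simp; ring
    have h4 : (f+b)^2/A ≤ 9 := by
      rw [div_le_iff₀ hAp, ← hb2]; nlinarith
    have h5 := mul_le_mul_of_nonneg_left h4 (sq_nonneg (f-b))
    nlinarith [mul_nonneg (by positivity : 0 ≤ g^2+s) hℓ0]
  · push Not at hc
    have h1 : f^2 ≤ 8*(g^2+s) := by nlinarith
    have h2 : f^2/A ≤ 8*(1+g^2/s) := by
      rw [div_le_iff₀ hAp]
      have : 8*(1+g^2/s)*s = 8*(g^2+s) := by field_simp; ring
      have h3 : s ≤ A := by rw [hA]; nlinarith [sq_nonneg f0]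
      have := mul_le_mul_of_nonneg_left h3 (by positivity : 0 ≤ 8*(1+g^2/s))
      linarith
    have h3 : Real.log (f^2/A) ≤ 7 + ℓ := by
      have h4 := Real.log_le_log (by positivity) h2
      rw [Real.log_mul (by norm_num) (by linarith)] at h4
      have := Real.log_le_sub_one_of_pos (show (0:ℝ) < 8 by norm_num)
      linarith
    have h4 : A ≤ f^2 := by rw [← hb2]; nlinarith
    have h5 := mul_le_mul_of_nonneg_left h3 hF.le
    have h6 := mul_le_mul_of_nonneg_right h1 (by linarith : 0 ≤ 7 + ℓ)
    nlinarith [mul_nonneg (by positivity : 0 ≤ g^2+s) hℓ0]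

lemma ent_var (γ φ : ℕ → ℝ) (N : ℕ) (hγ : ∀ n, n ≤ N → 0 ≤ γ n) (hφ : ∀ n, n ≤ N → 0 ≤ φ n)
    (hsum : ∑ n ∈ Finset.range (N+1), γ n = 1) {A : ℝ} (hA : 0 < A) :
    entGamma γ φ N ≤ ∑ n ∈ Finset.range (N+1), γ n * (φ n * Real.log (φ n) - φ n * Real.log A - φ n + A) := by
  unfold entGamma
  set m := ∑ n ∈ Finset.range (N+1), γ n * φ n with hm
  have hm0 : 0 ≤ m := Finset.sum_nonneg fun n hn => by
    have := Finset.mem_range.1 hn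
    exact mul_nonneg (hγ n (by omega)) (hφ n (by omega))
  have e : ∑ n ∈ Finset.range (N+1), γ n * (φ n * Real.log (φ n) - φ n * Real.log A - φ n + A) =
      ∑ n ∈ Finset.range (N+1), γ n * (φ n * Real.log (φ n)) - m * Real.log A - m + A := by
    have h1 : ∑ n ∈ Finset.range (N+1), γ n * A = A := by rw [← Finset.sum_mul, hsum, one_mul]
    have h2 : ∑ n ∈ Finset.range (N+1), γ n * (φ n * Real.log A) = m * Real.log A := by
      rw [hm, Finset.sum_mul]
      refine Finset.sum_congr rfl fun n _ => by ring
    simp only [mul_add, mul_sub, Finset.sum_add_distrib, Finset.sum_sub_distrib, h1, h2, ← hm]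
  rw [e]
  rcases hm0.eq_or_lt with h0 | hp
  · rw [← h0]; simp; linarith
  · have h1 := Real.log_le_sub_one_of_pos (show 0 < A/m by positivity)
    rw [Real.log_div hA.ne' hp.ne'] at h1
    have h2 := mul_le_mul_of_nonneg_left h1 hp.le
    have h3 : m * (A/m - 1) = A - m := by field_simp
    rw [h3] at h2
    linarith

lemma sum_two_halves (h : ℕ → ℝ) (N m : ℕ) (hm : m ≤ N) (h0 : ∀ n, n ≤ N → 0 ≤ h n) :
    ∑ n ∈ Finset.range (N+1), h n ≤ ∑ j ∈ Finset.range (N-m+1), h (m+j) + ∑ j ∈ Finset.range (m+1), h (m-j) := by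
  rw [Finset.sum_flip (f := h)]
  have e1 := Finset.sum_range_add_sum_Ico h (show m ≤ N+1 by omega)
  rw [← e1, Finset.sum_Ico_eq_sum_range, Finset.sum_range_succ _ m]
  have e2 : N + 1 - m = N - m + 1 := by omega
  rw [e2]
  have := h0 m hm
  linarith

/-- assumptions on the birth and death chain -/
structure Chain (a₁ δ κ K : ℝ) (N : ℕ) (γ Φ : ℕ → ℝ) : Prop where
  pos : ∀ n, n ≤ N → 0 < γ n
  rel : ∀ i, i < N → γ (i+1) * Φ (i+1) = γ i * Φ (N - i)
  sym : ∀ n, n ≤ N → γ (N - n) = γ n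
  lb : ∀ n : ℕ, δ * n ≤ Φ n
  ub : ∀ n : ℕ, Φ n ≤ a₁ * n
  lip : ∀ n m : ℕ, Φ (n+m) ≤ Φ n + a₁ * m
  inc : ∀ n m : ℕ, κ * m - K * Real.sqrt (n + m) ≤ Φ (n+m) - Φ n

lemma Chain.upper {a₁ δ κ K : ℝ} {N : ℕ} {γ Φ : ℕ → ℝ} (h : Chain a₁ δ κ K N γ Φ) (hN : 1 ≤ N)
    (hδ : 0 < δ) (ha : 0 < a₁) (hκ : 0 < κ) (hK : 0 ≤ K) {m : ℕ} (hm1 : N ≤ 2*m+1) (hm : m ≤ N)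
    (j : ℕ) (hj : j < N - m) :
    γ (m + (j+1)) ≤ γ (m + j) * Real.exp (-(κ/a₁ * (j+1) / N) + (2*(κ+K)/δ) / Real.sqrt N) := by
  have hN' : (1:ℝ) ≤ N := by exact_mod_cast hN
  set r := Real.sqrt N with hr
  have hr1 : 1 ≤ r := by rw [hr, Real.one_le_sqrt]; exact hN'
  have hrr : r * r = N := by rw [hr]; exact Real.mul_self_sqrt (by linarith)
  have hr0 : 0 < r := by linarith
  have hrel := h.rel (m+j) (by omega)
  rw [← add_assoc]
  set i := m + j + 1 with hi
  obtain ⟨d, hd⟩ : ∃ d, i = (N - (m+j)) + d := ⟨i - (N-(m+j)), by omega⟩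
  have hinc := h.inc (N-(m+j)) d
  rw [← hd] at hinc
  have hd2 : j ≤ d := by omega
  have hiN : i ≤ N := by omega
  have hi2 : N ≤ 2 * i := by omega
  have hd2' : (j:ℝ) ≤ d := by exact_mod_cast hd2
  have hiN' : (i:ℝ) ≤ N := by exact_mod_cast hiN
  have hi2' : (N:ℝ) ≤ 2 * i := by exact_mod_cast hi2
  have hsq : Real.sqrt (((N-(m+j):ℕ):ℝ) + d) ≤ r := by
    refine Real.sqrt_le_sqrt ?_
    have : (i:ℝ) = ((N-(m+j):ℕ):ℝ) + d := by rw [hd]; push_cast; ring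
    linarith
  set x := Φ i - Φ (N-(m+j)) with hx
  have hx1 : κ * (j+1) - (κ+K)*r ≤ x := by
    have h1 := mul_le_mul_of_nonneg_left hsq hK
    have h2 := mul_le_mul_of_nonneg_left hd2' hκ.le
    nlinarith
  have hΦ1 : δ * N / 2 ≤ Φ i := by
    have := h.lb i
    nlinarith
  have hΦ2 : Φ i ≤ a₁ * N := (h.ub i).trans (mul_le_mul_of_nonneg_left hiN' ha.le)
  have hΦp : 0 < Φ i := lt_of_lt_of_le (by positivity) hΦ1
  have hγ := h.pos (m+j) (by omega)
  have e : γ i = γ (m+j) * (1 - x / Φ i) := by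
    have : 1 - x/Φ i = Φ (N-(m+j)) / Φ i := by rw [hx]; field_simp; ring
    rw [this, mul_div_assoc', eq_div_iff hΦp.ne']; exact hrel
  rw [e]
  refine mul_le_mul_of_nonneg_left ?_ hγ.le
  have h1 := Real.add_one_le_exp (-(x/Φ i))
  have h2 : -(x/Φ i) ≤ -(κ/a₁ * (j+1) / N) + (2*(κ+K)/δ) / r := by
    have h3 : -(x/Φ i) ≤ ((κ+K)*r)/Φ i - κ*(j+1)/Φ i := by
      rw [← neg_div, ← sub_div]
      exact div_le_div_of_nonneg_right (by linarith) hΦp.le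
    have h4 : ((κ+K)*r)/Φ i ≤ ((κ+K)*r)/(δ*N/2) :=
      div_le_div_of_nonneg_left (by positivity) (by positivity) hΦ1
    have h5 : κ*(j+1)/(a₁*N) ≤ κ*(j+1)/Φ i :=
      div_le_div_of_nonneg_left (by positivity) hΦp hΦ2
    have e4 : ((κ+K)*r)/(δ*N/2) = (2*(κ+K)/δ) / r := by rw [← hrr]; field_simp
    have e5 : κ*(j+1)/(a₁*N) = κ/a₁ * (j+1) / N := by field_simp
    rw [e4] at h4; rw [e5] at h5
    linarith
  have h3 := Real.exp_le_exp.2 h2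
  linarith

lemma Chain.lower {a₁ δ κ K : ℝ} {N : ℕ} {γ Φ : ℕ → ℝ} (h : Chain a₁ δ κ K N γ Φ) (hN : 1 ≤ N)
    (hδ : 0 < δ) (ha : δ ≤ a₁) {m : ℕ} (hm1 : N ≤ 2*m+1) (hm2 : 2*m ≤ N+1) (hm : m ≤ N)
    (j : ℕ) (hj : j ≤ N - m) :
    γ m ≤ γ (m + j) * Real.exp ((16 + 8*a₁/δ) * (j:ℝ)^2 / N) := by
  have hN' : (1:ℝ) ≤ N := by exact_mod_cast hN
  have ha0 : 0 < a₁ := by linarith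
  have hq : 0 < a₁/δ := by positivity
  have good : ∀ j, j ≤ N - m → N ≤ 4*(N-m-j+1) → γ m ≤ γ (m+j) * Real.exp ((8*a₁/δ) * (j:ℝ)^2 / N) := by
    intro j
    induction j with
    | zero => intro _ _; simp
    | succ j ih =>
      intro hj h4
      have ih' := ih (by omega) (by omega)
      refine ih'.trans ?_
      have hrel := h.rel (m+j) (by omega)
      rw [← add_assoc]
      obtain ⟨d, hd⟩ : ∃ d, m+j+1 = (N - (m+j)) + d := ⟨m+j+1 - (N-(m+j)), by omega⟩
      have hlip := h.lip (N-(m+j)) d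
      rw [← hd] at hlip
      have hdj : (d:ℝ) ≤ 2*(j+1) := by
        have : d ≤ 2*(j+1) := by omega
        exact_mod_cast this
      have hNm : (N:ℝ) ≤ 4 * ((N-(m+j):ℕ):ℝ) := by
        have : N ≤ 4*(N-(m+j)) := by omega
        exact_mod_cast this
      have hlb := h.lb (N-(m+j))
      have hΦ0 : δ * N/4 ≤ Φ (N-(m+j)) := by nlinarith
      set P := Φ (N-(m+j)) with hP
      have hPp : 0 < P := lt_of_lt_of_le (by positivity) hΦ0
      have hg1 := h.pos (m+j+1) (by omega)
      have h5 : γ (m+j) ≤ γ (m+j+1) * Real.exp (8*a₁/δ*(j+1)/N) := by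
        have e1 : γ (m+j) = γ (m+j+1) * (Φ (m+j+1) / P) := by
          rw [mul_div_assoc', eq_div_iff hPp.ne']; exact hrel.symm
        rw [e1]
        refine mul_le_mul_of_nonneg_left ?_ hg1.le
        have h6 : Φ (m+j+1)/P ≤ 1 + a₁ * (2*(j+1))/P := by
          have : 1 + a₁ * (2*(j+1))/P = (P + a₁ * (2*((j:ℝ)+1)))/P := by field_simp
          rw [this]
          refine div_le_div_of_nonneg_right ?_ hPp.le
          have := mul_le_mul_of_nonneg_left hdj ha0.le
          linarith
        have h7 : a₁ * (2*((j:ℝ)+1))/P ≤ a₁ * (2*(j+1))/(δ*N/4) :=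
          div_le_div_of_nonneg_left (by positivity) (by positivity) hΦ0
        have h8 : a₁ * (2*((j:ℝ)+1))/(δ*N/4) = 8*a₁/δ*(j+1)/N := by field_simp; ring
        have := Real.add_one_le_exp (8*a₁/δ*((j:ℝ)+1)/N)
        linarith
      refine (mul_le_mul_of_nonneg_right h5 (Real.exp_pos _).le).trans ?_
      rw [mul_assoc, ← Real.exp_add]
      refine mul_le_mul_of_nonneg_left (Real.exp_le_exp.2 ?_) hg1.le
      rw [← add_div]
      refine div_le_div_of_nonneg_right ?_ (by linarith)
      have : 8*a₁/δ*((j:ℝ)+1) + 8*a₁/δ*(j:ℝ)^2 = 8*a₁/δ * (((j:ℝ)+1) + (j:ℝ)^2) := by ring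
      rw [this]
      refine mul_le_mul_of_nonneg_left ?_ (by positivity)
      push_cast
      have : (0:ℝ) ≤ j := Nat.cast_nonneg j
      nlinarith
  have crude : ∀ j, j ≤ N - m → γ m * (N.choose (m+j) : ℝ) ≤ γ (m+j) * (a₁/δ)^j * (N.choose m : ℝ) := by
    intro j
    induction j with
    | zero => intro _; simp
    | succ j ih =>
      intro hj
      have ih' := ih (by omega)
      have hrel := h.rel (m+j) (by omega)
      rw [← add_assoc]
      have hch : (N.choose (m+j+1) : ℝ) * ((m+j+1:ℕ):ℝ) = N.choose (m+j) * ((N-(m+j):ℕ):ℝ) := by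
        exact_mod_cast Nat.choose_succ_right_eq N (m+j)
      have hlb := h.lb (N-(m+j))
      have hub := h.ub (m+j+1)
      have hip : (0:ℝ) < ((m+j+1:ℕ):ℝ) := by positivity
      have hg1 := h.pos (m+j+1) (by omega)
      have hg0 := h.pos (m+j) (by omega)
      have h5 : γ (m+j) * ((N-(m+j):ℕ):ℝ) ≤ γ (m+j+1) * (a₁/δ) * ((m+j+1:ℕ):ℝ) := by
        have h6 := mul_le_mul_of_nonneg_left hlb hg0.le
        have h7 := mul_le_mul_of_nonneg_left hub hg1.le
        have h8 : δ * (γ (m+j) * ((N-(m+j):ℕ):ℝ)) ≤ δ * (γ (m+j+1) * (a₁/δ) * ((m+j+1:ℕ):ℝ)) := by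
          have : δ * (γ (m+j+1) * (a₁/δ) * ((m+j+1:ℕ):ℝ)) = γ (m+j+1) * (a₁ * ((m+j+1:ℕ):ℝ)) := by
            field_simp
          rw [this]; linarith
        exact le_of_mul_le_mul_left h8 hδ
      refine le_of_mul_le_mul_right ?_ hip
      calc γ m * (N.choose (m+j+1) : ℝ) * ((m+j+1:ℕ):ℝ) 
          = (γ m * N.choose (m+j)) * ((N-(m+j):ℕ):ℝ) := by rw [mul_assoc, hch]; ring
        _ ≤ (γ (m+j) * (a₁/δ)^j * (N.choose m : ℝ)) * ((N-(m+j):ℕ):ℝ) :=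
            mul_le_mul_of_nonneg_right ih' (Nat.cast_nonneg _)
        _ = (γ (m+j) * ((N-(m+j):ℕ):ℝ)) * ((a₁/δ)^j * (N.choose m : ℝ)) := by ring
        _ ≤ (γ (m+j+1) * (a₁/δ) * ((m+j+1:ℕ):ℝ)) * ((a₁/δ)^j * (N.choose m : ℝ)) :=
            mul_le_mul_of_nonneg_right h5 (by positivity)
        _ = _ := by rw [pow_succ]; ring
  have hgj := h.pos (m+j) (by omega)
  by_cases h4 : N ≤ 4*(N-m-j+1)
  · refine (good j hj h4).trans (mul_le_mul_of_nonneg_left (Real.exp_le_exp.2 ?_) hgj.le)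
    refine div_le_div_of_nonneg_right ?_ (by linarith)
    refine mul_le_mul_of_nonneg_right (by linarith) (sq_nonneg _)
  · push Not at h4
    have hNj : N ≤ 4*j := by omega
    have hNj' : (N:ℝ) ≤ 4*j := by exact_mod_cast hNj
    have hc := crude j hj
    have hc1 : (1:ℝ) ≤ N.choose (m+j) := by
      exact_mod_cast Nat.choose_pos (by omega)
    have hc2 : (N.choose m : ℝ) ≤ Real.exp N := by
      have h1 : N.choose m ≤ 2^N := Nat.choose_le_two_pow N m
      have h2 : (N.choose m : ℝ) ≤ 2^N := by exact_mod_cast h1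
      refine h2.trans ?_
      have : Real.exp N = Real.exp 1 ^ N := by rw [← Real.exp_nat_mul, mul_one]
      rw [this]
      refine pow_le_pow_left₀ (by norm_num) ?_ N
      have := Real.add_one_le_exp (1:ℝ); linarith
    have hc3 : (a₁/δ)^j ≤ Real.exp (j * (a₁/δ)) := by
      rw [Real.exp_nat_mul]
      refine pow_le_pow_left₀ hq.le ?_ j
      have := Real.add_one_le_exp (a₁/δ); linarith
    have hgm := h.pos m hm
    have h5 : γ m ≤ γ (m+j) * (Real.exp (j*(a₁/δ)) * Real.exp N) := by
      have h6 : γ m ≤ γ m * (N.choose (m+j) : ℝ) := le_mul_of_one_le_right hgm.le hc1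
      refine (h6.trans hc).trans ?_
      rw [mul_assoc]
      exact mul_le_mul_of_nonneg_left (mul_le_mul hc3 hc2 (Nat.cast_nonneg _) (Real.exp_pos _).le) hgj.le
    refine h5.trans (mul_le_mul_of_nonneg_left ?_ hgj.le)
    rw [← Real.exp_add]
    refine Real.exp_le_exp.2 ?_
    rw [le_div_iff₀ (by linarith)]
    have hj0 : (0:ℝ) ≤ j := Nat.cast_nonneg j
    have h6 : (N:ℝ)*N ≤ 16*(j:ℝ)^2 := by nlinarith
    have h7 : (j:ℝ)*N ≤ 4*(j:ℝ)^2 := by nlinarith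
    have h8 := mul_le_mul_of_nonneg_left h7 hq.le
    have e : 8*a₁/δ = 8*(a₁/δ) := by ring
    rw [e]
    nlinarith [mul_nonneg hq.le (sq_nonneg (j:ℝ))]

/-- abstract log-Sobolev inequality -/
lemma Chain.lsi {a₁ δ κ K : ℝ} (hδ : 0 < δ) (ha : δ ≤ a₁) (hκ : 0 < κ) (hK : 0 ≤ K) :
    ∃ C : ℝ, 0 < C ∧ ∀ (N : ℕ) (γ Φ : ℕ → ℝ), 1 ≤ N → Chain a₁ δ κ K N γ Φ →
      ∑ n ∈ Finset.range (N+1), γ n = 1 → ∀ φ : ℕ → ℝ, (∀ n, n ≤ N → 0 ≤ φ n) →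
      entGamma γ φ N ≤ C * (N * ∑ n ∈ Finset.range N, min (γ (n+1)) (γ n) *
        (Real.sqrt (φ (n+1)) - Real.sqrt (φ n))^2) := by
  have ha0 : 0 < a₁ := by linarith
  set δ₁ := κ/a₁ with hδ₁
  have hδ₁p : 0 < δ₁ := by positivity
  set K₁ := 2*(κ+K)/δ with hK₁
  have hK₁p : 0 ≤ K₁ := by positivity
  set C₃ := 16 + 8*a₁/δ with hC₃
  have hC₃p : 0 ≤ C₃ := by positivity
  set A := Real.exp ((K₁+2+δ₁)^2/(2*δ₁)) * (2 + 1/δ₁) with hA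
  have hAp : 0 < A := by positivity
  set c0 := 1/(2*A) with hc0
  have hc0p : 0 < c0 := by positivity
  set C' := (1 + 1/c0 + C₃) * (4 * (A * Real.exp K₁)^2) with hC'
  have hC'p : 0 < C' := by positivity
  refine ⟨224*C' + 56, by positivity, fun N γ Φ hN h hsum φ hφ => ?_⟩
  set f : ℕ → ℝ := fun n => Real.sqrt (φ n) with hf
  set m := N/2 with hm
  set m' := N - m with hm'
  have hmN : m ≤ N := by omega
  have hm'N : m' ≤ N := by omega
  set r := Real.sqrt N with hr
  have hN' : (1:ℝ) ≤ N := by exact_mod_cast hN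
  have hr1 : 1 ≤ r := by rw [hr, Real.one_le_sqrt]; exact hN'
  have hr0 : 0 < r := by linarith
  have hU1 := fun j hj => h.upper hN hδ ha0 hκ hK (m := m) (by omega) hmN j hj
  have hU2 := fun j hj => h.upper hN hδ ha0 hκ hK (m := m') (by omega) hm'N j hj
  have hL1 := fun j hj => h.lower hN hδ ha (m := m) (by omega) (by omega) hmN j hj
  have hL2 := fun j hj => h.lower hN hδ ha (m := m') (by omega) (by omega) hm'N j hj
  have hsym : γ m' = γ m := h.sym m hmN
  have hrefl : ∀ j, j ≤ m → γ (m - j) = γ (m' + j) := by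
    intro j hj
    have := h.sym (m-j) (by omega)
    rw [← this]; congr 1; omega
  have hp1 : ∀ j, j ≤ N - m → 0 < γ (m+j) := fun j hj => h.pos _ (by omega)
  have hp2 : ∀ j, j ≤ N - m' → 0 < γ (m'+j) := fun j hj => h.pos _ (by omega)
  have hNm' : N - m' = m := by omega
  -- mass
  have hmass : c0 ≤ γ m * r := by
    have t1 := half_tail (a := fun j => γ (m+j)) hN (by omega : N - m ≤ N) hr hδ₁p hK₁p hp1 hU1 0 (by omega)
    have t2 := half_tail (a := fun j => γ (m'+j)) hN (by omega : N - m' ≤ N) hr hδ₁p hK₁p hp2 hU2 0 (by omega)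
    have aux : ∀ (J : ℕ) (a : ℕ → ℝ), (∀ j, j ≤ J → 0 < a j) → ∑ j ∈ Finset.range (J+1), a j ≤ 
        ∑ j ∈ Finset.Ico 0 (J+1), a j * (1 + j / r)^2 := by
      intro J a hap
      rw [← Finset.range_eq_Ico]
      refine Finset.sum_le_sum fun j hj => ?_
      have := Finset.mem_range.1 hj
      refine le_mul_of_one_le_right (hap j (by omega)).le ?_
      have : (0:ℝ) ≤ j/r := by positivity
      nlinarith
    have s1 := (aux _ _ hp1).trans t1
    have s2 := (aux _ _ hp2).trans t2
    have s3 := sum_two_halves γ N m hmN fun n hn => (h.pos n hn).le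
    have s4 : ∑ j ∈ Finset.range (m+1), γ (m-j) = ∑ j ∈ Finset.range (N-m'+1), γ (m'+j) := by
      rw [hNm']
      refine Finset.sum_congr rfl fun j hj => hrefl j ?_
      have := Finset.mem_range.1 hj; omega
    rw [hsum, s4] at s3
    simp only [add_zero, Nat.cast_zero, zero_div, mul_one] at s1 s2
    rw [hsym, ← hA] at s2
    rw [← hA] at s1
    rw [hc0, div_le_iff₀ (by positivity)]
    linarith
  -- Dirichlet form
  set dd : ℕ → ℝ := fun n => min (γ (n+1)) (γ n) * (f (n+1) - f n)^2 with hdd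
  have hdd0 : ∀ n, n < N → 0 ≤ dd n := fun n hn =>
    mul_nonneg (le_min (h.pos _ (by omega)).le (h.pos _ (by omega)).le) (sq_nonneg _)
  set D := ∑ n ∈ Finset.range N, dd n with hD
  have hDnn : 0 ≤ D := Finset.sum_nonneg fun n hn => hdd0 n (Finset.mem_range.1 hn)
  change entGamma γ φ N ≤ (224*C'+56) * (N * D)
  refine le_of_forall_pos_le_add fun ε hε => ?_
  set s := N * D + ε/56 with hs
  have hsp : 0 < s := by positivity
  set g : ℕ → ℝ := fun n => f n - f m with hg
  -- right half
  have hD1 : ∑ k ∈ Finset.range (N-m), min (γ (m+(k+1))) (γ (m+k)) * (g (m+(k+1)) - g (m+k))^2 ≤ D := by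
    have e : ∀ k, min (γ (m+(k+1))) (γ (m+k)) * (g (m+(k+1)) - g (m+k))^2 = dd (m+k) := by
      intro k; simp only [hdd, hg, add_assoc]; congr 2; ring
    simp only [e]
    rw [← Finset.sum_Ico_eq_sum_range]
    refine Finset.sum_le_sum_of_subset_of_nonneg (fun n hn => ?_) fun n hn _ => hdd0 n (Finset.mem_range.1 hn)
    rw [Finset.mem_Ico] at hn; rw [Finset.mem_range]; omega
  have hD2 : ∑ k ∈ Finset.range (N-m'), min (γ (m'+(k+1))) (γ (m'+k)) * (g (m-(k+1)) - g (m-k))^2 ≤ D := by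
    have e : ∑ k ∈ Finset.range (N-m'), min (γ (m'+(k+1))) (γ (m'+k)) * (g (m-(k+1)) - g (m-k))^2 
        = ∑ k ∈ Finset.range m, dd (m-1-k) := by
      rw [hNm']
      refine Finset.sum_congr rfl fun k hk => ?_
      have hk' := Finset.mem_range.1 hk
      have e1 : m - 1 - k + 1 = m - k := by omega
      have e2 : m - 1 - k = m - (k+1) := by omega
      simp only [hdd, hg]
      rw [e1, e2, hrefl k (by omega), hrefl (k+1) (by omega), min_comm]
      ring
    rw [e, Finset.sum_range_reflect]
    exact Finset.sum_le_sum_of_subset_of_nonneg (Finset.range_mono hmN) fun n hn _ => hdd0 n (Finset.mem_range.1 hn)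
  have M1 := half_main (a := fun j => γ (m+j)) (g := fun j => g (m+j)) (s := s) hN (by omega : N - m ≤ N) hr hδ₁p hK₁p
    hC₃p hc0p hp1 hU1 hmass hL1 (by simp [hg]) hsp
    (by have := mul_le_mul_of_nonneg_left hD1 (by linarith : (0:ℝ) ≤ N); rw [hs]; linarith [div_pos hε (by norm_num : (0:ℝ) < 56)])
  have M2 := half_main (a := fun j => γ (m'+j)) (g := fun j => g (m-j)) (s := s) hN (by omega : N - m' ≤ N) hr hδ₁p hK₁p
    hC₃p hc0p hp2 hU2 (by simpa [hsym] using hmass) hL2 (by simp [hg]) hsp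
    (by have := mul_le_mul_of_nonneg_left hD2 (by linarith : (0:ℝ) ≤ N); rw [hs]; linarith [div_pos hε (by norm_num : (0:ℝ) < 56)])
  rw [← hA, ← hC'] at M1 M2
  have M1' := M1.trans (mul_le_mul_of_nonneg_left (mul_le_mul_of_nonneg_left hD1 (by linarith : (0:ℝ) ≤ N)) hC'p.le)
  have M2' := M2.trans (mul_le_mul_of_nonneg_left (mul_le_mul_of_nonneg_left hD2 (by linarith : (0:ℝ) ≤ N)) hC'p.le)
  set H : ℕ → ℝ := fun n => γ n * (g n^2 * (1 + Real.log (1 + g n^2/s))) with hH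
  have hH0 : ∀ n, n ≤ N → 0 ≤ H n := fun n hn => by
    have : 0 ≤ Real.log (1 + g n^2/s) := Real.log_nonneg (by have : 0 ≤ g n^2/s := by positivity
                                                             linarith)
    have := h.pos n hn
    positivity
  have hHs := sum_two_halves H N m hmN hH0
  have e2 : ∑ j ∈ Finset.range (m+1), H (m-j) = ∑ j ∈ Finset.range (N-m'+1),
      γ (m'+j) * (g (m-j)^2 * (1 + Real.log (1 + g (m-j)^2/s))) := by
    rw [hNm']
    refine Finset.sum_congr rfl fun j hj => ?_
    have hj' := Finset.mem_range.1 hj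
    simp only [hH]
    rw [hrefl j (by omega)]
  have hHtot : ∑ n ∈ Finset.range (N+1), H n ≤ 2 * (C' * (N*D)) := by
    rw [e2] at hHs
    have : ∑ j ∈ Finset.range (N-m+1), H (m+j) ≤ C' * (N*D) := M1'
    linarith
  have hv := ent_var γ φ N (fun n hn => (h.pos n hn).le) hφ hsum (A := (f m)^2 + s) (by positivity)
  refine hv.trans ?_
  have hb : ∑ n ∈ Finset.range (N+1), γ n * (φ n * Real.log (φ n) - φ n * Real.log ((f m)^2+s) - φ n + ((f m)^2+s)) ≤
      ∑ n ∈ Finset.range (N+1), (112 * H n + γ n * (56 * s)) := by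
    refine Finset.sum_le_sum fun n hn => ?_
    have hn' : n ≤ N := by have := Finset.mem_range.1 hn; omega
    have e : φ n = f n^2 := (Real.sq_sqrt (hφ n hn')).symm
    have hsc := scalar_bd (f := f n) (f0 := f m) (s := s) (Real.sqrt_nonneg _) (Real.sqrt_nonneg _) hsp
    rw [e]
    have := mul_le_mul_of_nonneg_left hsc (h.pos n hn').le
    simp only [hH, hg]
    linarith
  refine hb.trans ?_
  rw [Finset.sum_add_distrib, ← Finset.mul_sum, ← Finset.sum_mul, hsum]
  rw [hs]
  linarith

/-- Proposition 3.1: the birth and death chain reversible for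
`γ(n) = ν_Λ^N[η̄_{Λ₁} = n]` has logarithmic Sobolev constant of order `N`,
uniformly in `L` and `N`. -/
theorem statement2
    (c : ℕ → ℝ) (a₁ a₂ : ℝ) (k₀ : ℕ)
    (hc0 : c 0 = 0) (hcpos : ∀ n : ℕ, 0 < n → 0 < c n)
    (hLG : ∀ k : ℕ, |c (k + 1) - c k| ≤ a₁)
    (hk₀ : 0 < k₀) (ha₂ : 0 < a₂)
    (hM : ∀ j k : ℕ, j + k₀ ≤ k → a₂ ≤ c k - c j) :
    ∃ C : ℝ, 0 < C ∧ ∀ (a : ℤ) (L N : ℕ), 1 ≤ L → 1 ≤ N →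
      ∀ φ : ℕ → ℝ, (∀ n : ℕ, n ≤ N → 0 ≤ φ n) →
        entGamma (gammaP c a L N) φ N ≤
          C * (N : ℝ) * ∑ n ∈ Finset.Icc 1 N,
            min (gammaP c a L N n) (gammaP c a L N (n - 1)) *
              (Real.sqrt (φ n) - Real.sqrt (φ (n - 1))) ^ 2 := by
  obtain ⟨κc, Kc, hκc, hKc, hinc⟩ := c_incr c a₁ a₂ k₀ hLG hk₀ ha₂ hM
  obtain ⟨δ, hδ, hlow⟩ := c_lower c hc0 hcpos hκc hinc
  have hg := good_wt c a₁ hc0 hcpos hLG hlow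
  have hq := c_quad c hκc hinc
  have hvar := single_var c hg hδ (by positivity : 0 < κc/2) (by positivity : 0 ≤ Kc^2/(2*κc)) hq
  obtain ⟨κ, K, hκ, hK, hPhi⟩ := Phi_incr c hg hδ (by positivity) hvar
  obtain ⟨C, hC, hlsi⟩ := Chain.lsi hδ hg.a_ge hκ hK
  refine ⟨C, hC, fun a L N hL hN φ hφ => ?_⟩
  obtain ⟨L, rfl⟩ : ∃ L', L = L' + 1 := ⟨L - 1, by omega⟩
  have hV := good_Vc c hg L
  set V := Vc c L with hVdef
  set Φ := ratioSeq (L+1) V with hΦ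
  set W := cv V V N with hW
  have hWp : 0 < W := cv_pos hV.pos hV.pos N
  set γ := gammaP c a (L+1) N with hγ
  have hγe : ∀ n, n ≤ N → γ n = V n * V (N-n) / W := fun n hn => gammaP_eq c a L N n hn
  have hch : Chain a₁ δ κ K N γ Φ := by
    refine ⟨fun n hn => ?_, fun i hi => ?_, fun n hn => ?_, hV.lb, hV.ub, fun n m => ?_, fun n m => hPhi L n m⟩
    · rw [hγe n hn]
      exact div_pos (mul_pos (hV.pos _) (hV.pos _)) hWp
    · rw [hγe _ hi, hγe _ hi.le]
      obtain ⟨k, hk⟩ : ∃ k, N - i = k + 1 := ⟨N - i - 1, by omega⟩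
      have hk' : N - (i+1) = k := by omega
      rw [hk, hk']
      have h1 := hV.rcr i
      have h2 := hV.rcr k
      have e : V (i+1) * V k / W * Φ (i+1) = (Φ (i+1) * V (i+1)) * V k / W := by ring
      have e' : V i * V (k+1) / W * Φ (k+1) = V i * (Φ (k+1) * V (k+1)) / W := by ring
      rw [e, e', h1, h2]; ring
    · rw [hγe _ hn, hγe _ (Nat.sub_le N n), Nat.sub_sub_self hn, mul_comm]
    · induction m with
      | zero => simp
      | succ m ih =>
        have := hV.lip (n+m)
        rw [← add_assoc]; push_cast; linarith
  have hsum : ∑ n ∈ Finset.range (N+1), γ n = 1 := by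
    have e : ∑ n ∈ Finset.range (N+1), γ n = ∑ n ∈ Finset.range (N+1), V n * V (N-n) / W :=
      Finset.sum_congr rfl fun n hn => hγe n (by have := Finset.mem_range.1 hn; omega)
    rw [e, ← Finset.sum_div, ← cv_eq_range, ← hW, div_self hWp.ne']
  have hfin := hlsi N γ Φ hN hch hsum φ hφ
  refine hfin.trans (le_of_eq ?_)
  rw [mul_assoc]
  congr 2
  rw [Finset.range_eq_Ico]
  have h := Finset.sum_Ico_add' (fun n => min (γ n) (γ (n-1)) *
    (Real.sqrt (φ n) - Real.sqrt (φ (n-1)))^2) 0 N 1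
  simp only [Nat.add_sub_cancel] at h
  rw [h]
  refine Finset.sum_congr ?_ fun _ _ => rfl
  ext n
  simp only [Finset.mem_Ico, Finset.mem_Icc]
  omega
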